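/- Suppose n ≥ 5 is minimal with the property that the alternating group A_n has property (I_p) with respect to some subgroup H and some prime p ≤ n, where the triple (A_n, H, p) is not among the cases of the classification table for alternating groups. Then any such H is a primitive subgroup, i.e. the action of H on the n points is primitive (transitive and preserving no nontrivial block system). -/

import Mathlib

/-- A module is indecomposable if it is nonzero and admits no nontrivial direct sum
decomposition. -/
def IsIndecomposableModule (R M : Type*) [Ring R] [AddCommMonoid M] [Module R M] : Prop :=
  Nontrivial M ∧ ∀ N N' : Submodule R M, IsCompl N N' → N = ⊥ ∨ N' = ⊥

/-- The permutation module `k[G/H]`, as a module over the group algebra `k[G]`. -/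
abbrev PermMod (k : Type*) [Field k] {G : Type*} [Group G] (H : Subgroup G) :=
  (Representation.ofMulAction k G (G ⧸ H)).asModule

/-- A finite group `G` has property `(I_p)` with respect to a subgroup `H` if `H` is a
`p'`-subgroup and the permutation module `k[G/H]` is indecomposable (equivalently, it is the
projective cover of the trivial `k[G]`-module). -/
def HasIp (k : Type*) [Field k] {G : Type*} [Group G] (p : ℕ) (H : Subgroup G) : Prop :=
  ¬ (p ∣ Nat.card H) ∧ IsIndecomposableModule (MonoidAlgebra k G) (PermMod k H)

/-- The projective special linear group `PSL_3(2)`. -/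
abbrev PSL3F2 :=
  Matrix.SpecialLinearGroup (Fin 3) (ZMod 2) ⧸
    Subgroup.center (Matrix.SpecialLinearGroup (Fin 3) (ZMod 2))

/-- The classification table of triples `(A_n, H, p)` with `A_n` having property `(I_p)` with
respect to `H`. -/
def AltTable (n p : ℕ) (H : Subgroup ↥(alternatingGroup (Fin n))) : Prop :=
  -- (i) `n = p` prime, `H ≅ A_{n-1}` a point stabilizer, of index `n`
  (n = p ∧ (∃ a : Fin n, H = MulAction.stabilizer ↥(alternatingGroup (Fin n)) a) ∧
    Nonempty (↥H ≃* ↥(alternatingGroup (Fin (n - 1)))) ∧ H.index = n) ∨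
  -- (ii) `n = 5`, `p = 2`, `H ≅ C_5`, of index `12`
  (n = 5 ∧ p = 2 ∧ IsCyclic ↥H ∧ Nat.card H = 5 ∧ H.index = 12) ∨
  -- (iii) `n = 5`, `p = 3`, `H ≅ D_5` dihedral of order `10`, of index `6`
  (n = 5 ∧ p = 3 ∧ Nonempty (↥H ≃* DihedralGroup 5) ∧ H.index = 6) ∨
  -- (iv) `n = 6`, `p = 2`, `H ≅ C_3 × C_3` elementary abelian of order `9`, of index `40`
  (n = 6 ∧ p = 2 ∧
    Nonempty (↥H ≃* (Multiplicative (ZMod 3) × Multiplicative (ZMod 3))) ∧ H.index = 40) ∨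
  -- (v) `n = 6`, `p = 5`, `H ≅ 3^2:4` of order `36`, of index `10`
  (n = 6 ∧ p = 5 ∧ Nat.card H = 36 ∧
    (∃ N C : Subgroup ↥H, N.Normal ∧
      Nonempty (↥N ≃* (Multiplicative (ZMod 3) × Multiplicative (ZMod 3))) ∧
      IsCyclic ↥C ∧ Nat.card C = 4 ∧ N ⊓ C = ⊥ ∧ N ⊔ C = ⊤) ∧ H.index = 10) ∨
  -- (vi) `n = 7`, `p = 5`, `H ≅ PSL_3(2)` of order `168`, of index `15`
  (n = 7 ∧ p = 5 ∧ Nat.card H = 168 ∧ Nonempty (↥H ≃* PSL3F2) ∧ H.index = 15) ∨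
  -- (vii) `n = 8`, `p = 5`, `H ≅ 2^3:PSL_3(2)` of order `1344`, of index `15`
  (n = 8 ∧ p = 5 ∧ Nat.card H = 1344 ∧
    (∃ N C : Subgroup ↥H, N.Normal ∧ Nat.card N = 8 ∧ (∀ x ∈ N, x * x = 1) ∧
      Nonempty (↥C ≃* PSL3F2) ∧ N ⊓ C = ⊥ ∧ N ⊔ C = ⊤) ∧ H.index = 15)



open MonoidAlgebra in
theorem indec_sub {k G V : Type} [Field k] [Group G] [AddCommGroup V] [Module k V]
    (ρ : Representation k G V) (h : IsIndecomposableModule (MonoidAlgebra k G) ρ.asModule)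
    (N N' : Submodule k V) (hN : ∀ g, ∀ v ∈ N, ρ g v ∈ N) (hN' : ∀ g, ∀ v ∈ N', ρ g v ∈ N')
    (hc : IsCompl N N') : N = ⊥ ∨ N' = ⊥ := by
  have m1 : N ∈ ρ.invtSubmodule := ρ.mem_invtSubmodule.2 fun g v hv => hN g v hv
  have m2 : N' ∈ ρ.invtSubmodule := ρ.mem_invtSubmodule.2 fun g v hv => hN' g v hv
  have hc2 : IsCompl (⟨N, m1⟩ : ρ.invtSubmodule) ⟨N', m2⟩ := by
    constructor
    · rw [disjoint_iff]
      apply Subtype.ext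
      exact hc.inf_eq_bot
    · rw [codisjoint_iff]
      apply Subtype.ext
      exact hc.sup_eq_top
  have := h.2 _ _ (OrderIso.isCompl ρ.mapSubmodule hc2)
  simp only [map_eq_bot_iff] at this
  rcases this with h | h
  · left; exact congrArg Subtype.val h
  · right; exact congrArg Subtype.val h

theorem indec_of_sub {k G V : Type} [Field k] [Group G] [AddCommGroup V] [Module k V]
    [Nontrivial V]
    (ρ : Representation k G V) 
    (h : ∀ (N N' : Submodule k V), (∀ g, ∀ v ∈ N, ρ g v ∈ N) → (∀ g, ∀ v ∈ N', ρ g v ∈ N') →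
      IsCompl N N' → N = ⊥ ∨ N' = ⊥) : IsIndecomposableModule (MonoidAlgebra k G) ρ.asModule := by
  refine ⟨ρ.asModuleEquiv.symm.injective.nontrivial, fun N N' hc => ?_⟩
  have hc2 := OrderIso.isCompl ρ.mapSubmodule.symm hc
  have := h (ρ.mapSubmodule.symm N).1 (ρ.mapSubmodule.symm N').1
    (fun g v hv => ρ.mem_invtSubmodule.1 (ρ.mapSubmodule.symm N).2 g hv)
    (fun g v hv => ρ.mem_invtSubmodule.1 (ρ.mapSubmodule.symm N').2 g hv)
    ⟨disjoint_iff.2 (congrArg Subtype.val hc2.inf_eq_bot),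
      codisjoint_iff.2 (congrArg Subtype.val hc2.sup_eq_top)⟩
  rcases this with h | h
  · left
    have h' : ρ.mapSubmodule.symm N = ⊥ := Subtype.ext h
    simpa only [map_eq_bot_iff] using h'
  · right
    have h' : ρ.mapSubmodule.symm N' = ⊥ := Subtype.ext h
    simpa only [map_eq_bot_iff] using h'

/-- The intertwiner `k[G/H] → V` determined by an `H`-fixed vector. -/
noncomputable def UU {k G V : Type} [Field k] [Group G] [AddCommGroup V] [Module k V]
    (ρ : Representation k G V) (H : Subgroup G) (v : V) : MonoidAlgebra k (G ⧸ H) →ₗ[k] V :=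
  (Finsupp.linearCombination k (fun q : G ⧸ H => ρ q.out v)) ∘ₗ
    (MonoidAlgebra.coeffLinearEquiv k).toLinearMap

theorem UU_single {k G V : Type} [Field k] [Group G] [AddCommGroup V] [Module k V]
    (ρ : Representation k G V) (H : Subgroup G) (v : V) (hv : ∀ h ∈ H, ρ h v = v) (g : G) (r : k) :
    UU ρ H v (MonoidAlgebra.single (g : G ⧸ H) r) = r • ρ g v := by
  obtain ⟨h, hh⟩ := QuotientGroup.mk_out_eq_mul H g
  simp [UU, hh, hv]

theorem perm_ext {k G V : Type} [Field k] [Group G] [AddCommGroup V] [Module k V]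
    (H : Subgroup G) (f f' : MonoidAlgebra k (G ⧸ H) →ₗ[k] V)
    (h : ∀ g : G, f (MonoidAlgebra.single (g : G ⧸ H) 1) = f' (MonoidAlgebra.single (g : G ⧸ H) 1)) :
    f = f' := by
  apply MonoidAlgebra.lhom_ext'
  intro a
  induction a using QuotientGroup.induction_on with
  | H g => 
    ext
    simpa using h g

theorem UU_comm {k G V : Type} [Field k] [Group G] [AddCommGroup V] [Module k V]
    (ρ : Representation k G V) (H : Subgroup G) (v : V) (hv : ∀ h ∈ H, ρ h v = v) (g : G)
    (x : MonoidAlgebra k (G ⧸ H)) :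
    UU ρ H v (Representation.ofMulAction k G (G ⧸ H) g x) = ρ g (UU ρ H v x) := by
  have := perm_ext H (UU ρ H v ∘ₗ Representation.ofMulAction k G (G ⧸ H) g)
    (ρ g ∘ₗ UU ρ H v) (fun g' => by
      have : g • (g' : G ⧸ H) = ((g * g' : G) : G ⧸ H) := rfl
      simp [UU_single ρ H v hv, this])
  exact LinearMap.congr_fun this x

/-- The key property. -/
def KP (k : Type) [Field k] {G : Type} [Group G] [Fintype G] (H : Subgroup G) : Prop :=
  ∀ (V : Type) [AddCommGroup V] [Module k V] (ρ : Representation k G V) (v : V) (c : G → k),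
    (∀ h ∈ H, ρ h v = v) → ∑ g, c g • ρ g v = 0 → ∑ g, c g ≠ 0 → v = 0

theorem card_ne_zero_of {k G : Type} [Field k] [Group G] [Fintype G] {p : ℕ} [CharP k p]
    (H : Subgroup G) (h : ¬ p ∣ Nat.card H) : (Nat.card H : k) ≠ 0 := by
  rwa [Ne, CharP.cast_eq_zero_iff k p]

theorem KP_of_hasIp {k G : Type} [Field k] [Group G] [Fintype G] {p : ℕ} [CharP k p]
    {H : Subgroup G} (h : HasIp k p H) : KP k H := by
  classical
  intro V _ _ ρ v c hv hsum hc
  have hH : (Nat.card H : k) ≠ 0 := card_ne_zero_of H h.1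
  set X := MonoidAlgebra k (G ⧸ H)
  set π := Representation.ofMulAction k G (G ⧸ H) with hπ
  set v0 : X := MonoidAlgebra.single ((1 : G) : G ⧸ H) 1 with hv0
  have hv0' : ∀ h ∈ H, π h v0 = v0 := by
    intro h hh
    have : h • ((1 : G) : G ⧸ H) = ((1 : G) : G ⧸ H) := by
      change (((h * 1 : G)) : G ⧸ H) = _
      rw [QuotientGroup.eq]; simpa using hh
    rw [hv0, hπ, Representation.ofMulAction_single, this]
  have hUv : ∀ {W : Type} [AddCommGroup W] [Module k W] (τ : Representation k G W) (w : W)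
    (hw : ∀ h ∈ H, τ h w = w), UU τ H w v0 = w := by
    intro W _ _ τ w hw
    rw [hv0, UU_single τ H w hw]; simp
  set w : X := ∑ h : H, π h (∑ g, c g • π g v0) with hw
  have hwfix : ∀ h ∈ H, π h w = w := by
    intro h hh
    rw [hw, map_sum]
    refine Fintype.sum_equiv (Equiv.mulLeft (⟨h, hh⟩ : H)) _ _ ?_
    intro x
    simp [map_mul]
  set Θ : Module.End k X := UU π H w with hΘ
  have hΘc : ∀ g x, Θ (π g x) = π g (Θ x) := UU_comm π H w hwfix
  have hΘmc : ∀ m : ℕ, ∀ g x, (Θ ^ m) (π g x) = π g ((Θ ^ m) x) := by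
    intro m
    induction m with
    | zero => intro g x; simp
    | succ m ih => intro g x; rw [pow_succ, Module.End.mul_apply, Module.End.mul_apply, hΘc, ih]
  -- augmentation
  let tr : Representation k G k := Representation.trivial k G k
  have htr : ∀ (a : k), ∀ h ∈ H, tr h a = a := by intro a h _; simp [tr]
  let ε : X →ₗ[k] k := UU tr H 1
  have hε : ∀ g x, ε (π g x) = ε x := by
    intro g x
    have := UU_comm tr H 1 (htr 1) g x
    simpa [tr] using this
  have hε0 : ε v0 = 1 := hUv tr 1 (htr 1)
  have hεw : ε w = Nat.card H * ∑ g, c g := by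
    rw [hw]
    simp only [map_sum, hε, map_smul, hε0]
    simp [Nat.card_eq_fintype_card]
  have hεΘ : ∀ x, ε (Θ x) = (Nat.card H * ∑ g, c g) * ε x := by
    intro x
    have := perm_ext H (ε ∘ₗ Θ) ((Nat.card H * ∑ g, c g) • ε) (fun g => by
      have e1 : (MonoidAlgebra.single (g : G ⧸ H) 1 : X) = π g v0 := by
        rw [hv0, hπ, Representation.ofMulAction_single]
        change _ = MonoidAlgebra.single ((g * 1 : G) : G ⧸ H) 1
        rw [mul_one]
      rw [e1]
      simp only [LinearMap.comp_apply, LinearMap.smul_apply, hΘc, hε, hε0]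
      rw [hΘ, hUv π w hwfix, hεw]; simp)
    simpa using LinearMap.congr_fun this x
  have hs : (Nat.card H * ∑ g, c g : k) ≠ 0 := mul_ne_zero hH hc
  have hεΘm : ∀ m : ℕ, ε ((Θ ^ m) v0) ≠ 0 := by
    intro m
    induction m with
    | zero => simp [hε0]
    | succ m ih => rw [pow_succ', Module.End.mul_apply, hεΘ]; exact mul_ne_zero hs ih
  have : Module.Finite k X := by
    refine Module.Finite.equiv (MonoidAlgebra.coeffLinearEquiv (R := k) (S := k) (M := G ⧸ H)).symm
  obtain ⟨m, hm⟩ := (Θ.eventually_isCompl_ker_pow_range_pow.and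
    (Filter.eventually_ge_atTop 1)).exists
  have hb := indec_sub π h.2 (LinearMap.ker (Θ ^ m)) (LinearMap.range (Θ ^ m))
    (fun g x hx => by
      rw [LinearMap.mem_ker] at hx ⊢
      rw [hΘmc, hx, map_zero])
    (fun g x hx => by
      obtain ⟨y, rfl⟩ := hx
      exact ⟨π g y, hΘmc m g y⟩) hm.1
  have hr : LinearMap.range (Θ ^ m) = ⊤ := by
    rcases hb with hb | hb
    · have := hm.1.sup_eq_top
      rwa [hb, bot_sup_eq] at this
    · exfalso
      have : (Θ ^ m) v0 ∈ LinearMap.range (Θ ^ m) := ⟨v0, rfl⟩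
      rw [hb, Submodule.mem_bot] at this
      exact hεΘm m (by rw [this, map_zero])
  have : v0 ∈ LinearMap.range (Θ ^ m) := by rw [hr]; trivial
  obtain ⟨u, hu⟩ := this
  obtain ⟨m', rfl⟩ : ∃ m', m = m' + 1 := ⟨m - 1, by omega⟩
  rw [pow_succ', Module.End.mul_apply] at hu
  have hz : UU ρ H v w = 0 := by
    rw [hw]
    simp only [map_sum, UU_comm ρ H v hv, map_smul, hUv ρ v hv, hπ]
    refine Finset.sum_eq_zero fun h _ => ?_
    have := congrArg (ρ h) hsum
    simpa only [map_sum, map_smul, map_zero] using this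
  have hzz : UU ρ H v ∘ₗ Θ = 0 := by
    apply perm_ext
    intro g
    have e1 : (MonoidAlgebra.single (g : G ⧸ H) 1 : X) = π g v0 := by
      rw [hv0, hπ, Representation.ofMulAction_single]
      change _ = MonoidAlgebra.single ((g * 1 : G) : G ⧸ H) 1
      rw [mul_one]
    rw [e1, LinearMap.comp_apply, hΘc, hπ, UU_comm ρ H v hv, hΘ, hUv π w hwfix, hz]
    simp
  have h1 := LinearMap.congr_fun hzz ((Θ ^ m') u)
  rw [LinearMap.comp_apply, hu, hUv ρ v hv] at h1
  simpa using h1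

theorem KP.family {k G : Type} [Field k] [Group G] [Fintype G] {H : Subgroup G} (h : KP k H)
    {I : Type} [Fintype I] (γ : I → G) (c : I → k) {V : Type} [AddCommGroup V] [Module k V]
    (ρ : Representation k G V) (v : V) (hv : ∀ h ∈ H, ρ h v = v)
    (h0 : ∑ i, c i • ρ (γ i) v = 0) (h1 : ∑ i, c i ≠ 0) : v = 0 := by
  classical
  apply h V ρ v (fun g => ∑ i with γ i = g, c i) hv
  · rw [← h0, ← Finset.sum_fiberwise (s := Finset.univ) (g := γ)]
    refine Finset.sum_congr rfl fun g _ => ?_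
    rw [Finset.sum_smul]
    refine Finset.sum_congr rfl fun i hi => ?_
    rw [(Finset.mem_filter.1 hi).2]
  · have e := Finset.sum_fiberwise (s := Finset.univ) (g := γ) (f := c)
    intro h2
    apply h1
    rw [← e, ← h2]

/-- Function representation. -/
def fnRep (k G X : Type) [Field k] [Group G] [MulAction G X] : Representation k G (X → k) where
  toFun g := LinearMap.funLeft k k (fun x => g⁻¹ • x)
  map_one' := by ext; simp [LinearMap.funLeft]
  map_mul' a b := by
    apply LinearMap.ext; intro f; funext x
    simp [LinearMap.funLeft, mul_smul]

theorem fnRep_apply {k G X : Type} [Field k] [Group G] [MulAction G X] (g : G) (f : X → k) (x : X) :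
    fnRep k G X g f x = f (g⁻¹ • x) := rfl

/-- Right translation representation. -/
def rtRep (k G : Type) [Field k] [Group G] : Representation k G (G → k) where
  toFun g := LinearMap.funLeft k k (fun x => x * g)
  map_one' := by ext; simp [LinearMap.funLeft]
  map_mul' a b := by
    apply LinearMap.ext; intro f; funext x
    simp [LinearMap.funLeft, mul_assoc]

theorem KP.dual {k G X : Type} [Field k] [Group G] [Fintype G] {H : Subgroup G} (h : KP k H)
    [MulAction G X] [Fintype X] (f : X → k) (hf : ∀ h ∈ H, ∀ x, f (h • x) = f x) (h0 : f ≠ 0) :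
    ∃ c : X → k, ∀ g : G, ∑ x, c x * f (g • x) = 1 := by
  classical
  let A : (G → k) →ₗ[k] (X → k) :=
    ∑ g, (LinearMap.proj (R := k) (φ := fun _ : G => k) g).smulRight (fnRep k G X g f)
  let S : (G → k) →ₗ[k] k := ∑ g, LinearMap.proj (R := k) (φ := fun _ : G => k) g
  have hA : ∀ c, A c = ∑ g, c g • fnRep k G X g f := by
    intro c; simp [A]
  have hS : ∀ c, S c = ∑ g, c g := by intro c; simp [S]
  have hmem : S ∈ LinearMap.range A.dualMap := by
    rw [LinearMap.range_dualMap_eq_dualAnnihilator_ker, Submodule.mem_dualAnnihilator]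
    intro c hc
    rw [LinearMap.mem_ker, hA] at hc
    by_contra hne
    rw [hS] at hne
    apply h0
    refine h _ (fnRep k G X) f c (fun h hh => ?_) hc hne
    funext x
    rw [fnRep_apply, hf _ (H.inv_mem hh)]
  obtain ⟨φ, hφ⟩ := hmem
  refine ⟨fun x => φ (Pi.single x 1), fun g => ?_⟩
  have h1 := LinearMap.congr_fun hφ (Pi.single g⁻¹ 1)
  rw [hS, LinearMap.dualMap_apply, hA] at h1
  have h2 : ∑ g', (Pi.single g⁻¹ (1 : k) : G → k) g' • fnRep k G X g' f = fun x => f (g • x) := by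
    rw [Finset.sum_eq_single g⁻¹]
    · funext x; simp [fnRep_apply]
    · intro b _ hb; simp [Pi.single_eq_of_ne hb]
    · simp
  rw [h2] at h1
  rw [Finset.sum_pi_single'] at h1
  simp only [Finset.mem_univ, if_true] at h1
  rw [LinearMap.pi_apply_eq_sum_univ φ] at h1
  refine Eq.trans ?_ h1
  refine Finset.sum_congr rfl fun x _ => ?_
  rw [smul_eq_mul, mul_comm]
  have e : (Pi.single x (1 : k) : X → k) = fun j => if x = j then 1 else 0 := by
    funext j
    simp [Pi.single_apply, eq_comm]
  simp only [e]

theorem KP.order {k G : Type} [Field k] [Group G] [Fintype G] {p : ℕ} [CharP k p]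
    {H : Subgroup G} (h : KP k H) (K : Subgroup G) (hK : ¬ p ∣ Nat.card K) :
    Nat.card K ≤ Nat.card H := by
  classical
  have hK' := card_ne_zero_of (k := k) K hK
  have wd : ∀ f : G ⧸ H → k, ∀ a b : G, (QuotientGroup.leftRel K) a b →
      ∑ κ : K, f ((a * κ : G) : G ⧸ H) = ∑ κ : K, f ((b * κ : G) : G ⧸ H) := by
    intro f a b hab
    rw [QuotientGroup.leftRel_apply] at hab
    refine Fintype.sum_equiv (Equiv.mulLeft (⟨a⁻¹ * b, hab⟩ : K)⁻¹) _ _ ?_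
    intro x
    simp [mul_assoc]
  let Φ : (G ⧸ H → k) →ₗ[k] (G ⧸ K → k) :=
    { toFun := fun f q => Quotient.liftOn' q (fun g => ∑ κ : K, f ((g * κ : G) : G ⧸ H)) (wd f)
      map_add' := by
        intro f f'; funext q
        induction q using QuotientGroup.induction_on with
        | H g => exact Finset.sum_add_distrib
      map_smul' := by
        intro r f; funext q
        induction q using QuotientGroup.induction_on with
        | H g => exact (Finset.mul_sum _ _ _).symm }
  have hinj : Function.Injective Φ := by
    rw [← LinearMap.ker_eq_bot, LinearMap.ker_eq_bot']
    intro f hf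
    have hF : (fun x : G => f (x : G ⧸ H)) = 0 := by
      refine h.family (I := K) (fun κ => (κ : G)) (fun _ => 1) (rtRep k G) _ ?_ ?_ ?_
      · intro h hh
        funext x
        change f ((x * h : G) : G ⧸ H) = f (x : G ⧸ H)
        congr 1
        rw [QuotientGroup.eq]; simpa using hh
      · funext x
        have := congrFun hf (x : G ⧸ K)
        rw [Finset.sum_apply]
        refine Eq.trans ?_ this
        refine Finset.sum_congr rfl fun κ _ => ?_
        rw [one_smul]
        rfl
      · simpa [Nat.card_eq_fintype_card] using hK'
    funext q
    induction q using QuotientGroup.induction_on with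
    | H g => exact congrFun hF g
  have hle := LinearMap.finrank_le_finrank_of_injective hinj
  simp only [Module.finrank_fintype_fun_eq_card] at hle
  have e1 := H.card_mul_index
  have e2 := K.card_mul_index
  rw [Subgroup.index, Nat.card_eq_fintype_card (α := G ⧸ H)] at e1
  rw [Subgroup.index, Nat.card_eq_fintype_card (α := G ⧸ K)] at e2
  have hpos : 0 < Fintype.card (G ⧸ H) := Fintype.card_pos
  rw [← e2] at e1
  by_contra hlt
  push Not at hlt
  have : Nat.card H * Fintype.card (G ⧸ H) < Nat.card K * Fintype.card (G ⧸ K) :=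
    lt_of_lt_of_le (Nat.mul_lt_mul_of_pos_right hlt hpos) (Nat.mul_le_mul_left _ hle)
  omega

theorem KP.max {k G : Type} [Field k] [Group G] [Fintype G] {p : ℕ} [CharP k p]
    {H : Subgroup G} (h : KP k H) (K : Subgroup G) (hK : ¬ p ∣ Nat.card K) (hle : H ≤ K) :
    H = K :=
  Subgroup.eq_of_le_of_card_ge hle (h.order K hK)

theorem hasIp_of {k G : Type} [Field k] [Group G] [Fintype G] {p : ℕ} 
    {H : Subgroup G} (hp : ¬ p ∣ Nat.card H)
    (h : ∀ (v : MonoidAlgebra k (G ⧸ H)) (c : G → k),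
      (∀ h ∈ H, Representation.ofMulAction k G (G ⧸ H) h v = v) →
      ∑ g, c g • Representation.ofMulAction k G (G ⧸ H) g v = 0 → ∑ g, c g ≠ 0 → v = 0) :
    HasIp k p H := by
  classical
  refine ⟨hp, ?_⟩
  apply indec_of_sub
  intro N N' hN hN' hc
  set π := Representation.ofMulAction k G (G ⧸ H) with hπ
  set v0 : MonoidAlgebra k (G ⧸ H) := MonoidAlgebra.single ((1 : G) : G ⧸ H) 1 with hv0
  have hπ0 : ∀ g : G, π g v0 = MonoidAlgebra.single (g : G ⧸ H) 1 := by
    intro g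
    rw [hv0, hπ, Representation.ofMulAction_single]
    change MonoidAlgebra.single ((g * 1 : G) : G ⧸ H) 1 = _
    rw [mul_one]
  have hv0' : ∀ h ∈ H, π h v0 = v0 := by
    intro h hh
    rw [hπ0, hv0]
    congr 1
    rw [QuotientGroup.eq]; simpa using hh
  have hspan : ∀ w : MonoidAlgebra k (G ⧸ H), ∃ c : G → k, w = ∑ g, c g • π g v0 := by
    intro w
    induction w using MonoidAlgebra.induction_linear with
    | zero => exact ⟨0, by simp⟩
    | add x y hx hy =>
      obtain ⟨c, rfl⟩ := hx
      obtain ⟨d, rfl⟩ := hy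
      exact ⟨c + d, by simp [add_smul, Finset.sum_add_distrib]⟩
    | single q r =>
      induction q using QuotientGroup.induction_on with
      | H g => 
        refine ⟨Pi.single g r, ?_⟩
        rw [Finset.sum_eq_single g]
        · simp [hπ0]
        · intro b _ hb; simp [hb]
        · simp
  obtain ⟨a, ha, b, hb, hab⟩ := Submodule.mem_sup.1 (show v0 ∈ N ⊔ N' by rw [hc.sup_eq_top]; trivial)
  obtain ⟨c, hcc⟩ := hspan a
  have key : ∀ a' b' : MonoidAlgebra k (G ⧸ H), a' ∈ N → b' ∈ N' → a' + b' = 0 → a' = 0 ∧ b' = 0 := by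
    intro a' b' h1 h2 h3
    have h4 : a' = - b' := eq_neg_of_add_eq_zero_left h3
    have h5 : a' ∈ N ⊓ N' := ⟨h1, by rw [h4]; exact N'.neg_mem h2⟩
    rw [hc.inf_eq_bot, Submodule.mem_bot] at h5
    exact ⟨h5, by rw [h5] at h3; simpa using h3⟩
  have hafix : ∀ h ∈ H, π h a = a ∧ π h b = b := by
    intro h hh
    have e := hv0' h hh
    rw [← hab, map_add] at e
    have := key (π h a - a) (π h b - b) (N.sub_mem (hN h a ha) ha) (N'.sub_mem (hN' h b hb) hb)
      (by rw [← sub_eq_zero] at e; rw [← e]; abel)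
    exact ⟨sub_eq_zero.1 this.1, sub_eq_zero.1 this.2⟩
  have hx : ∑ g, c g • π g a - a = 0 ∧ ∑ g, c g • π g b = 0 := by
    apply key
    · exact N.sub_mem (N.sum_mem fun g _ => N.smul_mem _ (hN g a ha)) ha
    · exact (N'.sum_mem fun g _ => N'.smul_mem _ (hN' g b hb))
    · rw [← sub_eq_zero, ← hab] at hcc
      simp only [map_add, smul_add, Finset.sum_add_distrib] at hcc
      rw [← neg_eq_zero, ← hcc]; abel
  have finish : ∀ M : Submodule k (MonoidAlgebra k (G ⧸ H)), (∀ g, ∀ v ∈ M, π g v ∈ M) →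
      v0 ∈ M → M = ⊤ := by
    intro M hM h0
    rw [eq_top_iff]
    intro w _
    obtain ⟨d, rfl⟩ := hspan w
    exact M.sum_mem fun g _ => M.smul_mem _ (hM g _ h0)
  by_cases hs : ∑ g, c g = 0
  · left
    have : a = 0 := by
      refine h a (fun g => (Pi.single (1 : G) (1 : k) : G → k) g - c g) (fun h hh => (hafix h hh).1) ?_ ?_
      · simp only [sub_smul, Finset.sum_sub_distrib]
        rw [Finset.sum_eq_single (1 : G)]
        · have := hx.1
          rw [sub_eq_zero] at this
          rw [this]; simp
        · intro b _ hb; simp [hb]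
        · simp
      · rw [Finset.sum_sub_distrib, hs]; simp
    have h1 : N' = ⊤ := finish N' hN' (by rw [← hab, this, zero_add]; exact hb)
    have := hc.inf_eq_bot
    rwa [h1, inf_top_eq] at this
  · right
    have : b = 0 := h b c (fun h hh => (hafix h hh).2) hx.2 hs
    have h1 : N = ⊤ := finish N hN (by rw [← hab, this, add_zero]; exact ha)
    have := hc.inf_eq_bot
    rwa [h1, top_inf_eq] at this

theorem KP.sub {k G L : Type} [Field k] [Group G] [Fintype G] [Group L] [Fintype L] {p : ℕ}
    {H : Subgroup G} (h : KP k H) (hp : ¬ p ∣ Nat.card H) (ι : L →* G) (hι : Function.Injective ι)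
    (hH : H ≤ ι.range) : HasIp k p (H.comap ι) := by
  classical
  have hcard : Nat.card (H.comap ι) = Nat.card H := by
    have e1 : (H.comap ι).map ι = H := by
      rw [Subgroup.map_comap_eq, inf_eq_right]; exact hH
    rw [← e1, Subgroup.card_map_of_injective hι, e1]
  apply hasIp_of (by rw [hcard]; exact hp)
  intro v c hv h0 h1
  let φ : L ⧸ H.comap ι → G ⧸ H := Quotient.map' ι (by
    intro a b hab
    rw [QuotientGroup.leftRel_apply] at hab ⊢
    simpa using hab)
  have hφ : ∀ l : L, φ (l : L ⧸ H.comap ι) = ((ι l : G) : G ⧸ H) := fun l => rfl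
  have hφi : Function.Injective φ := by
    intro a b
    induction a using QuotientGroup.induction_on with
    | H a => 
    induction b using QuotientGroup.induction_on with
    | H b => 
    intro hab
    rw [hφ, hφ, QuotientGroup.eq] at hab
    rw [QuotientGroup.eq, Subgroup.mem_comap]
    simpa using hab
  let J : MonoidAlgebra k (L ⧸ H.comap ι) →ₗ[k] MonoidAlgebra k (G ⧸ H) :=
    MonoidAlgebra.mapDomainLinearMap k k φ
  have hJi : Function.Injective J := MonoidAlgebra.mapDomain_injective hφi
  have hJ : ∀ l v, J (Representation.ofMulAction k L _ l v) =
      Representation.ofMulAction k G _ (ι l) (J v) := by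
    intro l v
    have := perm_ext _ (J ∘ₗ Representation.ofMulAction k L (L ⧸ H.comap ι) l)
      (Representation.ofMulAction k G (G ⧸ H) (ι l) ∘ₗ J) (fun g => by
        have e1 : l • (g : L ⧸ H.comap ι) = ((l * g : L) : L ⧸ H.comap ι) := rfl
        have e2 : ι l • ((ι g : G) : G ⧸ H) = ((ι l * ι g : G) : G ⧸ H) := rfl
        simp [J, e1, hφ, e2])
    exact LinearMap.congr_fun this v
  apply hJi
  rw [map_zero]
  refine h.family ι c (Representation.ofMulAction k G (G ⧸ H)) (J v) ?_ ?_ h1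
  · intro g hg
    obtain ⟨l, rfl⟩ := hH hg
    rw [← hJ, hv l hg]
  · have := congrArg J h0
    simpa only [map_sum, map_smul, hJ, map_zero] using this

theorem KP.quot {k Q L : Type} [Field k] [Group Q] [Fintype Q] [Group L] [Fintype L] {p : ℕ}
    {H : Subgroup L} (h : KP k H) (hp : ¬ p ∣ Nat.card H) (π : L →* Q)
    (hπ : Function.Surjective π) : HasIp k p (H.map π) := by
  have hcard : Nat.card (H.map π) ∣ Nat.card H := Subgroup.card_map_dvd H π
  apply hasIp_of (fun hd => hp (hd.trans hcard))
  intro v c hv h0 h1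
  refine h.family (Function.surjInv hπ) c
    ((Representation.ofMulAction k Q (Q ⧸ H.map π)).comp π) v ?_ ?_ h1
  · intro g hg
    exact hv _ (Subgroup.mem_map_of_mem π hg)
  · rw [← h0]
    refine Finset.sum_congr rfl fun q _ => ?_
    rw [MonoidHom.comp_apply, Function.surjInv_eq hπ]


/-- Octahedral alternating sum. -/
def OO {α k : Type} [DecidableEq α] [Field k] : List (α × α) → (Finset α → k) → k
  | [], F => F ∅
  | (a, b) :: L, F => OO L (fun T => F (insert a T) - F (insert b T))

/-- The pairs of the list are disjoint and inside `U`. -/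
def Good {α : Type} [DecidableEq α] : Finset α → List (α × α) → Prop
  | _, [] => True
  | U, (a, b) :: L => a ∈ U ∧ b ∈ U ∧ a ≠ b ∧ Good ((U.erase a).erase b) L

theorem exists_perm_list {α : Type} [Finite α] (l l' : List α) (h : l.Nodup) (h' : l'.Nodup)
    (hl : l.length = l'.length) : ∃ g : Equiv.Perm α, l.map g = l' := by
  have := Equiv.Perm.isMultiplyPretransitive α l.length
  let x : Fin l.length ↪ α := ⟨fun i => l.get i, List.nodup_iff_injective_get.1 h⟩
  let y : Fin l.length ↪ α := ⟨fun i => l'.get (i.cast hl),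
    fun i j hij => by simpa using List.nodup_iff_injective_get.1 h' hij⟩
  obtain ⟨g, hg⟩ := MulAction.exists_smul_eq (Equiv.Perm α) x y
  refine ⟨g, List.ext_getElem (by simpa using hl) fun i h1 h2 => ?_⟩
  have := DFunLike.congr_fun hg ⟨i, by simpa using h1⟩
  simpa [x, y] using this

section
variable {α k : Type} [DecidableEq α] [Field k]

theorem OO_congr : ∀ (L : List (α × α)) (U : Finset α) (F F' : Finset α → k), Good U L →
    (∀ T, T ⊆ U → T.card = L.length → F T = F' T) → OO L F = OO L F' := by
  intro L
  induction L with
  | nil => intro U F F' _ h; exact h ∅ (by simp) (by simp)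
  | cons ab L ih =>
    obtain ⟨a, b⟩ := ab
    intro U F F' hg h
    obtain ⟨ha, hb, hab, hg⟩ := hg
    refine ih _ _ _ hg ?_
    intro T hT hc
    have haT : a ∉ T := fun h => by have := hT h; simp at this
    have hbT : b ∉ T := fun h => by have := hT h; simp at this
    have hTU : T ⊆ U := hT.trans ((Finset.erase_subset _ _).trans (Finset.erase_subset _ _))
    rw [h _ (Finset.insert_subset ha hTU) (by rw [Finset.card_insert_of_notMem haT, hc]; rfl),
      h _ (Finset.insert_subset hb hTU) (by rw [Finset.card_insert_of_notMem hbT, hc]; rfl)]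

theorem OO_sub : ∀ (L : List (α × α)) (F F' : Finset α → k),
    OO L (fun T => F T - F' T) = OO L F - OO L F' := by
  intro L
  induction L with
  | nil => intro F F'; rfl
  | cons ab L ih =>
    obtain ⟨a, b⟩ := ab
    intro F F'
    simp only [OO]
    rw [← ih]
    congr 1
    funext T
    ring

theorem ssum_insert (d : Finset α → k) (a : α) (T : Finset α) (ha : a ∉ T) :
    ∑ R ∈ (insert a T).ssubsets, d R = ∑ R ∈ T.powerset, d R + ∑ R ∈ T.ssubsets, d (insert a R) := by
  have h : ∀ (S : Finset α) (e : Finset α → k), ∑ R ∈ S.powerset, e R = ∑ R ∈ S.ssubsets, e R + e S := by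
    intro S e
    rw [Finset.ssubsets, Finset.sum_erase_add]
    simp
  have h1 := Finset.sum_powerset_insert ha d
  rw [h (insert a T) d, h T (fun R => d (insert a R))] at h1
  have := add_right_cancel (h1.trans (add_assoc _ _ _).symm)
  exact this

theorem OO_low : ∀ (L : List (α × α)) (U : Finset α) (F d : Finset α → k), Good U L →
    (∀ T, T ⊆ U → T.card = L.length → F T = ∑ R ∈ T.ssubsets, d R) → OO L F = 0 := by
  intro L
  induction L with
  | nil =>
    intro U F d _ h
    have := h ∅ (by simp) (by simp)
    rw [OO, this]
    rfl
  | cons ab L ih =>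
    obtain ⟨a, b⟩ := ab
    intro U F d hg h
    obtain ⟨ha, hb, hab, hg⟩ := hg
    refine ih _ _ (fun R => d (insert a R) - d (insert b R)) hg ?_
    intro T hT hc
    have haT : a ∉ T := fun h => by have := hT h; simp at this
    have hbT : b ∉ T := fun h => by have := hT h; simp at this
    have hTU : T ⊆ U := hT.trans ((Finset.erase_subset _ _).trans (Finset.erase_subset _ _))
    rw [h _ (Finset.insert_subset ha hTU) (by rw [Finset.card_insert_of_notMem haT, hc]; rfl),
      h _ (Finset.insert_subset hb hTU) (by rw [Finset.card_insert_of_notMem hbT, hc]; rfl),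
      ssum_insert d a T haT, ssum_insert d b T hbT, Finset.sum_sub_distrib]
    ring

theorem Good_spare : ∀ (L : List (α × α)) (U : Finset α), Good U L → 2 * L.length < U.card →
    ∃ b ∈ U, Good (U.erase b) L := by
  intro L
  induction L with
  | nil =>
    intro U _ h
    obtain ⟨b, hb⟩ := Finset.card_pos.1 (lt_of_le_of_lt (Nat.zero_le _) h)
    exact ⟨b, hb, trivial⟩
  | cons ab L ih =>
    obtain ⟨a, b⟩ := ab
    intro U hg h
    obtain ⟨ha, hb, hab, hg⟩ := hg
    have hb' : b ∈ U.erase a := by simp [hb, hab.symm]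
    have hcard : ((U.erase a).erase b).card = U.card - 2 := by
      rw [Finset.card_erase_of_mem hb', Finset.card_erase_of_mem ha]; omega
    simp only [List.length_cons] at h
    obtain ⟨x, hx, hgx⟩ := ih _ hg (by omega)
    simp only [Finset.mem_erase] at hx
    refine ⟨x, hx.2.2, by simp [ha, Ne.symm hx.2.1], by simp [hb, Ne.symm hx.1], hab, ?_⟩
    rw [Finset.erase_right_comm (a := x) (b := a), Finset.erase_right_comm (a := x) (b := b)]
    exact hgx

theorem rep_small (U : Finset α) (j : ℕ) (hU : U.card < 2 * j) (c : Finset α → k) :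
    ∃ d : Finset α → k, ∀ T, T ⊆ U → T.card = j → c T = ∑ R ∈ T.ssubsets, d R := by
  refine ⟨fun R => ∑ T ∈ U.powersetCard j, if R ⊆ U \ T then c T * (-1) ^ R.card else 0, ?_⟩
  intro S hS hSc
  rw [Finset.sum_comm]
  rw [Finset.sum_eq_single S]
  · rw [← Finset.sum_filter]
    have : S.ssubsets.filter (fun R => R ⊆ U \ S) = {∅} := by
      ext R
      simp only [Finset.mem_filter, Finset.mem_ssubsets, Finset.mem_singleton]
      constructor
      · rintro ⟨h1, h2⟩
        rw [Finset.eq_empty_iff_forall_notMem]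
        intro x hx
        have := h2 hx
        rw [Finset.mem_sdiff] at this
        exact this.2 (h1.1 hx)
      · rintro rfl
        refine ⟨?_, by simp⟩
        rw [Finset.empty_ssubset]
        apply Finset.card_pos.1; omega
    rw [this]; simp
  · intro T hT hTS
    rw [Finset.mem_powersetCard] at hT
    rw [← Finset.sum_filter]
    have : S.ssubsets.filter (fun R => R ⊆ U \ T) = (S \ T).powerset := by
      ext R
      simp only [Finset.mem_filter, Finset.mem_ssubsets, Finset.mem_powerset]
      constructor
      · rintro ⟨h1, h2⟩ x hx
        have := h2 hx
        rw [Finset.mem_sdiff] at this ⊢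
        exact ⟨h1.1 hx, this.2⟩
      · intro h
        have h2 : R ⊆ U \ T := h.trans (Finset.sdiff_subset_sdiff hS le_rfl)
        refine ⟨⟨h.trans Finset.sdiff_subset, fun h3 => ?_⟩, h2⟩
        have h4 := Finset.card_le_card (h3.trans h2)
        rw [Finset.card_sdiff_of_subset hT.1] at h4
        omega
    rw [this, ← Finset.mul_sum]
    have h5 : S \ T ≠ ∅ := by
      intro h6
      rw [Finset.sdiff_eq_empty_iff_subset] at h6
      exact hTS (Finset.eq_of_subset_of_card_le h6 (by omega)).symm
    have h7 := Finset.sum_powerset_neg_one_pow_card (x := S \ T)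
    rw [if_neg h5] at h7
    have h8 : (∑ m ∈ (S \ T).powerset, (-1 : k) ^ m.card) = 0 := by exact_mod_cast congrArg (Int.cast : ℤ → k) h7
    rw [h8, mul_zero]
  · intro h
    exact absurd (Finset.mem_powersetCard.2 ⟨hS, hSc⟩) h

theorem rep_lemma (U : Finset α) : ∀ (j : ℕ) (c : Finset α → k),
    (∀ L, Good U L → L.length = j → OO L c = 0) →
    ∃ d : Finset α → k, ∀ T, T ⊆ U → T.card = j → c T = ∑ R ∈ T.ssubsets, d R := by
  induction U using Finset.induction_on with
  | empty =>
    intro j c h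
    rcases j with _ | j
    · refine ⟨0, fun T hT hc => ?_⟩
      rw [Finset.card_eq_zero] at hc
      subst hc
      have := h [] trivial rfl
      simpa [OO] using this
    · refine ⟨0, fun T hT hc => ?_⟩
      rw [Finset.subset_empty] at hT
      subst hT
      simp at hc
  | insert u U hu ih =>
    intro j c h
    rcases j with _ | j
    · refine ⟨0, fun T hT hc => ?_⟩
      rw [Finset.card_eq_zero] at hc
      subst hc
      have := h [] trivial rfl
      simpa [OO] using this
    by_cases hsmall : (insert u U).card < 2 * (j + 1)
    · exact rep_small _ _ hsmall c
    have hUc : 2 * j < U.card := by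
      rw [Finset.card_insert_of_notMem hu] at hsmall; omega
    have good_mono : ∀ (L : List (α × α)) (A B : Finset α), A ⊆ B → Good A L → Good B L := by
      intro L
      induction L with
      | nil => intros; trivial
      | cons ab L ih =>
        intro A B hAB hg
        exact ⟨hAB hg.1, hAB hg.2.1, hg.2.2.1,
          ih _ _ (Finset.erase_subset_erase _ (Finset.erase_subset_erase _ hAB)) hg.2.2.2⟩
    obtain ⟨d1, hd1⟩ := ih (j + 1) c (fun L hL hl => h L (good_mono L _ _ (Finset.subset_insert _ _) hL) hl)
    obtain ⟨d2, hd2⟩ := ih j (fun T => c (insert u T) - ∑ R ∈ (insert u T).ssubsets, d1 R) (by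
      intro L hL hl
      obtain ⟨b, hb, hg⟩ := Good_spare L U hL (by omega)
      have hub : u ≠ b := fun h => hu (h ▸ hb)
      have hgood : Good (insert u U) ((u, b) :: L) := by
        refine ⟨by simp, by simp [hb], hub, ?_⟩
        rw [Finset.erase_insert hu]; exact hg
      have h1 := h _ hgood (by simp [hl])
      have h2 := OO_low ((u, b) :: L) (insert u U) (fun T => ∑ R ∈ T.ssubsets, d1 R) d1 hgood
        (fun T _ _ => rfl)
      have h3 := OO_sub ((u, b) :: L) c (fun T => ∑ R ∈ T.ssubsets, d1 R)
      rw [h1, h2, sub_zero] at h3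
      rw [← h3]
      simp only [OO]
      refine OO_congr L _ _ _ hg ?_
      intro T hT hc
      have hbT : b ∉ T := fun h => by have := hT h; simp at this
      rw [hd1 (insert b T) (Finset.insert_subset hb (hT.trans (Finset.erase_subset _ _)))
        (by rw [Finset.card_insert_of_notMem hbT, hc, hl])]
      ring)
    refine ⟨fun R => d1 R + if u ∈ R then d2 (R.erase u) else 0, ?_⟩
    intro T hT hc
    by_cases huT : u ∈ T
    · obtain ⟨T', hT'u, rfl⟩ : ∃ T', u ∉ T' ∧ T = insert u T' :=
        ⟨T.erase u, by simp, (Finset.insert_erase huT).symm⟩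
      have hT'U : T' ⊆ U := by
        intro x hx
        have := hT (Finset.mem_insert_of_mem hx)
        rw [Finset.mem_insert] at this
        rcases this with rfl | h
        · exact absurd hx hT'u
        · exact h
      rw [Finset.card_insert_of_notMem hT'u] at hc
      have e := hd2 T' hT'U (by omega)
      rw [Finset.sum_add_distrib, sub_eq_iff_eq_add.1 e, add_comm]
      congr 1
      rw [ssum_insert _ u T' hT'u]
      have z : ∑ R ∈ T'.powerset, (if u ∈ R then d2 (R.erase u) else 0) = 0 := by
        refine Finset.sum_eq_zero fun R hR => ?_
        rw [if_neg fun h => hT'u (Finset.mem_powerset.1 hR h)]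
      rw [z, zero_add]
      refine Finset.sum_congr rfl fun R hR => ?_
      have : u ∉ R := fun h => hT'u ((Finset.mem_ssubsets.1 hR).1 h)
      simp [this]
    · have hTU : T ⊆ U := by
        intro x hx
        have := hT hx
        rw [Finset.mem_insert] at this
        rcases this with rfl | h
        · exact absurd hx huT
        · exact h
      rw [hd1 T hTU hc]
      refine Finset.sum_congr rfl fun R hR => ?_
      simp only []
      rw [if_neg fun h => huT ((Finset.mem_ssubsets.1 hR).1 h), add_zero]

theorem prod_lemma : ∀ (L : List (α × α)) (U : Finset α) (c f : Finset α → k) (κ : k), Good U L →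
    (∀ T, T ⊆ U → T.card ≠ L.length → f T = 0) →
    (∀ σ : Equiv.Perm α, (∀ x, x ∉ U → σ x = x) → ∑ T ∈ U.powerset, c T * f (T.image σ) = κ) →
    (L ≠ [] ∨ κ = 0) → OO L c * OO L f = 0 := by
  intro L
  induction L with
  | nil =>
    intro U c f κ _ hs hσ hκ
    have hκ : κ = 0 := by simpa using hκ
    have h := hσ 1 (by simp)
    rw [Finset.sum_eq_single ∅, hκ] at h
    · simpa [OO] using h
    · intro T hT hne
      have : Finset.image (1 : Equiv.Perm α) T = T := by simp
      rw [this, hs T (Finset.mem_powerset.1 hT) (by simpa using hne), mul_zero]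
    · simp
  | cons ab L ih =>
    obtain ⟨a, b⟩ := ab
    intro U c f κ hg hs hσ _
    obtain ⟨ha, hb, hab, hg⟩ := hg
    set U' := (U.erase a).erase b with hU'
    have haU' : a ∉ U' := by simp [hU']
    have hbU' : b ∉ U' := by simp [hU']
    have hU : U = insert a (insert b U') := by
      rw [hU', Finset.insert_erase (by simp [hb, hab.symm]), Finset.insert_erase ha]
    have haU'' : a ∉ insert b U' := by simp [hab, haU']
    refine ih U' _ _ 0 hg ?_ ?_ (Or.inr rfl)
    · intro T hT hc
      have haT : a ∉ T := fun h => haU' (hT h)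
      have hbT : b ∉ T := fun h => hbU' (hT h)
      have hTU : T ⊆ U := hT.trans ((Finset.erase_subset _ _).trans (Finset.erase_subset _ _))
      rw [hs _ (Finset.insert_subset ha hTU) (by rw [Finset.card_insert_of_notMem haT]; simpa using hc),
        hs _ (Finset.insert_subset hb hTU) (by rw [Finset.card_insert_of_notMem hbT]; simpa using hc),
        sub_zero]
    · intro σ hσ'
      have h1 := hσ σ (fun x hx => hσ' x fun h => hx (by rw [hU]; simp [h]))
      have h2 := hσ (σ * Equiv.swap a b) (fun x hx => by
        have hxa : x ≠ a := fun h => hx (h ▸ ha)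
        have hxb : x ≠ b := fun h => hx (h ▸ hb)
        rw [Equiv.Perm.mul_apply, Equiv.swap_apply_of_ne_of_ne hxa hxb]
        exact hσ' x fun h => hx (by rw [hU]; simp [h]))
      have h3 : (∑ T ∈ U.powerset, c T * f (T.image σ)) -
        ∑ T ∈ U.powerset, c T * f (T.image (σ * Equiv.swap a b)) = 0 := by rw [h1, h2, sub_self]
      rw [hU, Finset.sum_powerset_insert haU'', Finset.sum_powerset_insert hbU',
        Finset.sum_powerset_insert hbU', Finset.sum_powerset_insert haU'',
        Finset.sum_powerset_insert hbU', Finset.sum_powerset_insert hbU'] at h3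
      have sa : σ a = a := hσ' a haU'
      have sb : σ b = b := hσ' b hbU'
      rw [← h3]
      simp only [← Finset.sum_add_distrib, ← Finset.sum_sub_distrib]
      refine Finset.sum_congr rfl fun T hT => ?_
      rw [Finset.mem_powerset] at hT
      have haT : a ∉ T := fun h => haU' (hT h)
      have hbT : b ∉ T := fun h => hbU' (hT h)
      have i1 : T.image (σ * Equiv.swap a b) = T.image σ := by
        refine Finset.image_congr fun x hx => ?_
        have hxa : x ≠ a := fun h => haT (h ▸ hx)
        have hxb : x ≠ b := fun h => hbT (h ▸ hx)
        rw [Equiv.Perm.mul_apply, Equiv.swap_apply_of_ne_of_ne hxa hxb]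
      simp only [Finset.image_insert, i1, Equiv.Perm.mul_apply, Equiv.swap_apply_left,
        Equiv.swap_apply_right, sa, sb, Finset.insert_comm b a]
      ring

/-- Points of a list of pairs. -/
def ptsL : List (α × α) → List α
  | [] => []
  | (a, b) :: L => a :: b :: ptsL L

theorem ptsL_good : ∀ (L : List (α × α)) (U : Finset α), Good U L →
    (ptsL L).Nodup ∧ (∀ x ∈ ptsL L, x ∈ U) ∧ (ptsL L).length = 2 * L.length := by
  intro L
  induction L with
  | nil => intro U _; simp [ptsL]
  | cons ab L ih =>
    obtain ⟨a, b⟩ := ab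
    intro U hg
    obtain ⟨ha, hb, hab, hg⟩ := hg
    obtain ⟨h1, h2, h3⟩ := ih _ hg
    refine ⟨?_, ?_, ?_⟩
    · simp only [ptsL, List.nodup_cons, List.mem_cons, not_or]
      refine ⟨⟨hab, fun h => ?_⟩, fun h => ?_, h1⟩
      · have := h2 _ h; simp at this
      · have := h2 _ h; simp at this
    · intro x hx
      simp only [ptsL, List.mem_cons] at hx
      rcases hx with rfl | rfl | hx
      · exact ha
      · exact hb
      · exact Finset.mem_of_mem_erase (Finset.mem_of_mem_erase (h2 x hx))
    · simp [ptsL, h3]; ring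

theorem OO_image (g : Equiv.Perm α) : ∀ (L L' : List (α × α)) (f : Finset α → k),
    (ptsL L).map g = ptsL L' → OO L (fun T => f (T.image g)) = OO L' f := by
  intro L
  induction L with
  | nil =>
    intro L' f h
    rcases L' with _ | ⟨⟨a, b⟩, L'⟩
    · simp [OO]
    · simp [ptsL] at h
  | cons ab L ih =>
    obtain ⟨a, b⟩ := ab
    intro L' f h
    rcases L' with _ | ⟨⟨a', b'⟩, L'⟩
    · simp [ptsL] at h
    · simp only [ptsL, List.map_cons, List.cons.injEq] at h
      obtain ⟨rfl, rfl, h⟩ := h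
      simp only [OO, Finset.image_insert]
      exact ih L' (fun T => f (insert (g a) T) - f (insert (g b) T)) h

open Pointwise in
theorem lemJ [Fintype α] {H : Subgroup ↥(alternatingGroup α)} (hKP : KP k H) (j : ℕ) (hj : 1 ≤ j)
    (f : Finset α → k) (hs : ∀ T, T.card ≠ j → f T = 0)
    (hinv : ∀ h ∈ H, ∀ T, f (T.image (h : Equiv.Perm α)) = f T)
    (hodd : ∃ τ : Equiv.Perm α, Equiv.Perm.sign τ = -1 ∧ ∀ T, f (T.image τ) = f T)
    (hψ : ∀ R : Finset α, R.card < j → ∑ T with R ⊆ T, f T = 0)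
    (L : List (α × α)) (hL : Good Finset.univ L) (hlen : L.length = j) : OO L f = 0 := by
  by_contra hne
  have hf0 : f ≠ 0 := by
    rintro rfl
    apply hne
    have := OO_sub L (0 : Finset α → k) 0
    rw [sub_self] at this
    rw [← this]
    congr 1
    funext T
    simp
  obtain ⟨c, hc⟩ := hKP.dual f (fun h hh T => hinv h hh T) hf0
  have hc2 : ∀ g : Equiv.Perm α, ∑ T, c T * f (T.image g) = 1 := by
    intro g
    obtain ⟨τ, hτ, hτf⟩ := hodd
    rcases Int.units_eq_one_or (Equiv.Perm.sign g) with h | h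
    · exact hc ⟨g, h⟩
    · rw [← hc ⟨τ * g, by rw [Equiv.Perm.mem_alternatingGroup]; simp [hτ, h]⟩]
      refine Finset.sum_congr rfl fun T _ => ?_
      congr 1
      rw [← hτf, Finset.image_image]
      rfl
  have hcL : ∀ L', Good Finset.univ L' → L'.length = j → OO L' c = 0 := by
    intro L' hL' hl'
    obtain ⟨n1, -, n2⟩ := ptsL_good L _ hL
    obtain ⟨m1, -, m2⟩ := ptsL_good L' _ hL'
    obtain ⟨g, hg⟩ := exists_perm_list (ptsL L') (ptsL L) m1 n1 (by rw [m2, n2, hl', hlen])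
    have h1 := OO_image g L' L f hg
    have h2 := prod_lemma L' Finset.univ c (fun T => f (T.image g)) 1 hL'
      (fun T _ hT => hs _ (by rw [Finset.card_image_of_injective _ g.injective, ← hl']; exact hT))
      (fun σ _ => by
        rw [← hc2 (g * σ), Finset.powerset_univ]
        refine Finset.sum_congr rfl fun T _ => ?_
        rw [Finset.image_image]
        rfl) (Or.inl (by intro h; rw [h] at hl'; simp at hl'; omega))
    rw [h1] at h2
    exact (mul_eq_zero.1 h2).resolve_right hne
  obtain ⟨d, hd⟩ := rep_lemma Finset.univ j c hcL
  have h1 := hc2 1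
  have h2 : ∑ T, c T * f (T.image (1 : Equiv.Perm α)) =
      ∑ T : Finset α, ∑ R : Finset α, if R ⊂ T then d R * f T else 0 := by
    refine Finset.sum_congr rfl fun T _ => ?_
    have : Finset.image (1 : Equiv.Perm α) T = T := by simp
    rw [this]
    by_cases hT : T.card = j
    · rw [hd T (Finset.subset_univ _) hT, Finset.sum_mul, ← Finset.sum_filter]
      refine Finset.sum_congr ?_ fun _ _ => rfl
      ext R; simp
    · simp [hs T hT]
  rw [h2, Finset.sum_comm] at h1
  rw [Finset.sum_eq_zero] at h1
  · exact zero_ne_one h1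
  · intro R _
    by_cases hR : R.card < j
    · rw [← Finset.sum_filter, ← Finset.mul_sum]
      have := hψ R hR
      rw [← Finset.sum_subset (s₁ := Finset.univ.filter (fun T : Finset α => R ⊂ T))] at this
      · rw [this, mul_zero]
      · intro T
        simp only [Finset.mem_filter, Finset.mem_univ, true_and]
        exact fun h => h.1
      · intro T h1 h2
        simp only [Finset.mem_filter, Finset.mem_univ, true_and] at h1 h2
        have : T = R := by
          by_contra hne
          exact h2 (Finset.ssubset_iff_subset_ne.2 ⟨h1, Ne.symm hne⟩)
        apply hs; rw [this]; omega
    · refine Finset.sum_eq_zero fun T _ => ?_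
      split_ifs with h
      · have := Finset.card_lt_card h
        rw [hs T (by omega), mul_zero]
      · rfl
end


section
variable {α k : Type} [DecidableEq α] [Field k] [Fintype α]

theorem psi_step (j : ℕ) (f : Finset α → k) (hs : ∀ T, T.card ≠ j → f T = 0) (R : Finset α) :
    ∑ i with i ∉ R, ∑ T with insert i R ⊆ T, f T = ((j : k) - R.card) * ∑ T with R ⊆ T, f T := by
  simp only [Finset.sum_filter]
  have h1 : ∀ i, (if i ∉ R then ∑ T : Finset α, (if insert i R ⊆ T then f T else 0) else 0) =
      ∑ T : Finset α, if R ⊆ T then (if i ∈ T \ R then f T else 0) else 0 := by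
    intro i
    by_cases hi : i ∈ R
    · rw [if_neg (by simpa using hi)]
      symm
      refine Finset.sum_eq_zero fun T _ => ?_
      simp [hi]
    · rw [if_pos hi]
      refine Finset.sum_congr rfl fun T _ => ?_
      simp only [Finset.insert_subset_iff, Finset.mem_sdiff, hi, not_false_eq_true, and_true]
      by_cases h2 : i ∈ T <;> by_cases h3 : R ⊆ T <;> simp [h2, h3]
  rw [Finset.sum_congr rfl fun i _ => h1 i, Finset.sum_comm, Finset.mul_sum]
  refine Finset.sum_congr rfl fun T _ => ?_
  by_cases hR : R ⊆ T
  · simp only [hR, if_true]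
    rw [← Finset.sum_filter, Finset.sum_const, Finset.filter_mem_eq_inter, Finset.univ_inter,
      Finset.card_sdiff_of_subset hR, nsmul_eq_mul, Nat.cast_sub (Finset.card_le_card hR)]
    by_cases hT : T.card = j
    · rw [hT]
    · rw [hs T hT]; simp
  · simp [hR]

theorem psi_top (j : ℕ) (f : Finset α → k) (hs : ∀ T, T.card ≠ j → f T = 0) (R : Finset α)
    (hR : R.card + 1 = j) :
    ∑ T with R ⊆ T, f T = ∑ i with i ∉ R, f (insert i R) := by
  have h := psi_step j f hs R
  rw [← hR] at h
  push_cast at h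
  rw [add_sub_cancel_left, one_mul] at h
  rw [← h]
  refine Finset.sum_congr rfl fun i hi => ?_
  rw [Finset.mem_filter] at hi
  rw [Finset.sum_eq_single (insert i R)]
  · intro T hT hne
    rw [Finset.mem_filter] at hT
    apply hs
    intro hc
    apply hne
    symm
    apply Finset.eq_of_subset_of_card_le hT.2
    rw [Finset.card_insert_of_notMem hi.2]; omega
  · intro h; simp at h

/-- Vanishing of all lower sums from the top ones, when the relevant integers are invertible. -/
theorem psi_down (j m0 : ℕ) (f : Finset α → k) (hs : ∀ T, T.card ≠ j → f T = 0)
    (htop : ∀ R : Finset α, R.card + 1 = j → ∑ T with R ⊆ T, f T = 0)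
    (hinv : ∀ m, m0 ≤ m → m + 1 < j → ((j : k) - m) ≠ 0) (R : Finset α) (h0 : m0 ≤ R.card)
    (hR : R.card < j) :
    ∑ T with R ⊆ T, f T = 0 := by
  obtain ⟨t, ht⟩ : ∃ t, R.card + 1 + t = j := ⟨j - R.card - 1, by omega⟩
  induction t generalizing R with
  | zero => exact htop R ht
  | succ t ih =>
    have h := psi_step j f hs R
    rw [Finset.sum_eq_zero] at h
    · exact (mul_eq_zero.1 h.symm).resolve_left (hinv _ h0 (by omega))
    · intro i hi
      rw [Finset.mem_filter] at hi
      have hc := Finset.card_insert_of_notMem hi.2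
      exact ih _ (by omega) (by omega) (by omega)

/-- Functions of sets depending on the intersection with `A`. -/
def fA (A : Finset α) (j : ℕ) (G : ℕ → k) (T : Finset α) : k :=
  if T.card = j then G (T ∩ A).card else 0

theorem fA_image (A : Finset α) (j : ℕ) (G : ℕ → k) (σ : Equiv.Perm α) (hσ : A.image σ = A)
    (T : Finset α) : fA A j G (T.image σ) = fA A j G T := by
  have h : T.image σ ∩ A = (T ∩ A).image σ := by
    rw [Finset.image_inter _ _ σ.injective, hσ]
  rw [fA, fA, h, Finset.card_image_of_injective _ σ.injective,
    Finset.card_image_of_injective _ σ.injective]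

theorem exists_odd_pres (A : Finset α) (h : 3 ≤ Fintype.card α) :
    ∃ τ : Equiv.Perm α, Equiv.Perm.sign τ = -1 ∧ A.image τ = A := by
  have key : ∃ x y : α, x ≠ y ∧ (x ∈ A ↔ y ∈ A) := by
    by_cases hA : 1 < A.card
    · obtain ⟨x, hx, y, hy, hxy⟩ := Finset.one_lt_card.1 hA
      exact ⟨x, y, hxy, by simp [hx, hy]⟩
    · have : 1 < (Aᶜ).card := by rw [Finset.card_compl]; omega
      obtain ⟨x, hx, y, hy, hxy⟩ := Finset.one_lt_card.1 this
      rw [Finset.mem_compl] at hx hy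
      exact ⟨x, y, hxy, by simp [hx, hy]⟩
  obtain ⟨x, y, hxy, hA⟩ := key
  refine ⟨Equiv.swap x y, Equiv.Perm.sign_swap hxy, ?_⟩
  apply Finset.eq_of_subset_of_card_le
  · intro z hz
    obtain ⟨w, hw, rfl⟩ := Finset.mem_image.1 hz
    rw [Equiv.swap_apply_def]
    split_ifs with h1 h2
    · subst h1; exact hA.1 hw
    · subst h2; exact hA.2 hw
    · exact hw
  · rw [Finset.card_image_of_injective _ (Equiv.injective _)]

theorem fA_top (A : Finset α) (j : ℕ) (G : ℕ → k) (R : Finset α) (hR : R.card + 1 = j) :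
    ∑ T with R ⊆ T, fA A j G T = ((A.card : k) - (R ∩ A).card) * G ((R ∩ A).card + 1) +
      (Fintype.card α - A.card - (R.card - (R ∩ A).card)) * G (R ∩ A).card := by
  rw [psi_top j _ (fun T hT => by rw [fA, if_neg hT]) R hR]
  have h1 : ∀ i ∈ Finset.univ.filter (fun i => i ∉ R), fA A j G (insert i R) =
      if i ∈ A then G ((R ∩ A).card + 1) else G (R ∩ A).card := by
    intro i hi
    rw [Finset.mem_filter] at hi
    rw [fA, Finset.card_insert_of_notMem hi.2, if_pos hR]
    split_ifs with hA
    · rw [Finset.insert_inter_of_mem hA, Finset.card_insert_of_notMem]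
      simp [hi.2]
    · rw [Finset.insert_inter_of_notMem hA]
  rw [Finset.sum_congr rfl h1, Finset.sum_ite, Finset.sum_const, Finset.sum_const, nsmul_eq_mul,
    nsmul_eq_mul]
  have e1 : (Finset.univ.filter (fun i => i ∉ R)).filter (fun i => i ∈ A) = A \ (R ∩ A) := by
    ext i; simp; tauto
  have e2 : (Finset.univ.filter (fun i => i ∉ R)).filter (fun i => i ∉ A) = (R ∪ A)ᶜ := by
    ext i; simp
  have e3 : ((R ∪ A).card : k) = R.card + A.card - (R ∩ A).card := by
    rw [eq_sub_iff_add_eq]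
    rw [← Nat.cast_add, ← Nat.cast_add, Finset.card_union_add_card_inter]
  rw [e1, e2, Finset.card_sdiff_of_subset Finset.inter_subset_right,
    Nat.cast_sub (Finset.card_le_card Finset.inter_subset_right), Finset.card_compl,
    Nat.cast_sub (Finset.card_le_univ _), e3]
  ring

theorem lemJ_A {H : Subgroup ↥(alternatingGroup α)} (hKP : KP k H) (hn : 3 ≤ Fintype.card α)
    (A : Finset α) (hA : ∀ h ∈ H, A.image (h : Equiv.Perm α) = A) (j : ℕ) (hj : 1 ≤ j) (G : ℕ → k)
    (hψ : ∀ R : Finset α, R.card < j → ∑ T with R ⊆ T, fA A j G T = 0)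
    (L : List (α × α)) (hL : Good Finset.univ L) (hlen : L.length = j) : OO L (fA A j G) = 0 := by
  refine lemJ hKP j hj _ (fun T hT => by rw [fA, if_neg hT])
    (fun h hh T => fA_image A j G _ (hA h hh) T) ?_ hψ L hL hlen
  obtain ⟨τ, h1, h2⟩ := exists_odd_pres A hn
  exact ⟨τ, h1, fun T => fA_image A j G τ h2 T⟩

theorem intrans1 {H : Subgroup ↥(alternatingGroup α)} (hKP : KP k H) (hn : 3 ≤ Fintype.card α)
    (A : Finset α) (hA : ∀ h ∈ H, A.image (h : Equiv.Perm α) = A) (h0 : A.Nonempty)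
    (h1 : A ≠ Finset.univ) : ((Fintype.card α : ℕ) : k) = 0 ∧ (A.card : k) ≠ 0 := by
  obtain ⟨a, ha⟩ := h0
  obtain ⟨b, hb⟩ : ∃ b, b ∉ A := by
    by_contra h; push Not at h; exact h1 (Finset.eq_univ_iff_forall.2 h)
  have hab : a ≠ b := fun h => hb (h ▸ ha)
  have key : ∀ G : ℕ → k, (A.card : k) * G 1 + (Fintype.card α - A.card) * G 0 = 0 → G 1 = G 0 := by
    intro G hG
    have := lemJ_A hKP hn A hA 1 le_rfl G (fun R hR => by
      have : R = ∅ := Finset.card_eq_zero.1 (by omega)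
      subst this
      rw [fA_top _ _ _ _ (by simp)]
      simpa using hG) [(a, b)] ⟨by simp, by simp, hab, trivial⟩ rfl
    simpa [OO, fA, ha, hb, sub_eq_zero] using this
  have hn0 : ((Fintype.card α : ℕ) : k) = 0 := by
    by_contra hne
    have := key (fun i => if i = 1 then (Fintype.card α - A.card : k) else -A.card) (by
      simp; ring)
    simp at this
    apply hne
    linear_combination this
  refine ⟨hn0, fun hs => ?_⟩
  have := key (fun i => if i = 1 then 1 else 0) (by simp [hs])
  simp at this

theorem intrans2 {H : Subgroup ↥(alternatingGroup α)} (hKP : KP k H) (hn : 3 ≤ Fintype.card α)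
    (A : Finset α) (hA : ∀ h ∈ H, A.image (h : Equiv.Perm α) = A) (h0 : 2 ≤ A.card)
    (h1 : A.card + 2 ≤ Fintype.card α) : (2 : k) = 0 ∧ A.card % 4 ≠ 1 := by
  have hn0 := (intrans1 hKP hn A hA (Finset.card_pos.1 (by omega))
    (fun h => by rw [h, Finset.card_univ] at h1; omega)).1
  obtain ⟨a1, ha1, a2, ha2, ha⟩ := Finset.one_lt_card.1 (show 1 < A.card by omega)
  obtain ⟨b1, hb1, b2, hb2, hb⟩ := Finset.one_lt_card.1
    (show 1 < (Aᶜ).card by rw [Finset.card_compl]; omega)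
  rw [Finset.mem_compl] at hb1 hb2
  have h11 : a1 ≠ b1 := fun h => hb1 (h ▸ ha1)
  have h12 : a1 ≠ b2 := fun h => hb2 (h ▸ ha1)
  have h21 : a2 ≠ b1 := fun h => hb1 (h ▸ ha2)
  have h22 : a2 ≠ b2 := fun h => hb2 (h ▸ ha2)
  have key : ∀ G : ℕ → k, ((A.card - 1 : k) * G 2 + (Fintype.card α - A.card) * G 1 = 0) →
      ((A.card : k) * G 1 + (Fintype.card α - A.card - 1) * G 0 = 0) →
      ((2 : k) = 0 → ∑ T, fA A 2 G T = 0) → G 2 - 2 * G 1 + G 0 = 0 := by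
    intro G e1 e2 e3
    have htop : ∀ R : Finset α, R.card + 1 = 2 → ∑ T with R ⊆ T, fA A 2 G T = 0 := by
      intro R hR
      rw [fA_top A 2 G R hR]
      obtain ⟨x, rfl⟩ := Finset.card_eq_one.1 (show R.card = 1 by omega)
      by_cases hx : x ∈ A
      · simpa [hx] using e1
      · simpa [hx] using e2
    have := lemJ_A hKP hn A hA 2 (by norm_num) G (fun R hR => by
      by_cases h2 : (2 : k) = 0
      · by_cases hR1 : R.card + 1 = 2
        · exact htop R hR1
        · have : R = ∅ := Finset.card_eq_zero.1 (by omega)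
          subst this
          simpa using e3 h2
      · refine psi_down 2 0 _ (fun T hT => by rw [fA, if_neg hT]) htop ?_ R (by omega) hR
        intro m _ hm
        have : m = 0 := by omega
        subst this
        simpa using h2) [(a1, b1), (a2, b2)] ⟨by simp, by simp, h11, by simp [ha.symm, h21],
          by simp [h12.symm, hb.symm], h22, trivial⟩ rfl
    simp [OO, fA, ha1, hb1, ha2, hb2, Finset.card_pair, ha, ha.symm, hb, hb.symm,
      h11, h12, h21, h22, h11.symm, h12.symm, h21.symm, h22.symm] at this
    linear_combination this
  have h2 : (2 : k) = 0 := by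
    by_contra h2
    have := key (fun i => if i = 2 then (A.card : k) * (A.card + 1) else if i = 1 then
      (A.card : k) ^ 2 - 1 else (A.card : k) * (A.card - 1)) (by simp [hn0]; ring)
      (by simp [hn0]; ring) (fun h => absurd h h2)
    simp at this
    apply h2
    linear_combination this
  refine ⟨h2, fun h4 => ?_⟩
  obtain ⟨t, ht⟩ : ∃ t, A.card = 4 * t + 1 := ⟨A.card / 4, by omega⟩
  have := key (fun i => if i = 2 then 1 else 0) (by
    rw [ht]; simp; left; linear_combination 2 * h2) (by simp) (by
    intro _
    have : ∑ T, fA A 2 (fun i => if i = 2 then (1 : k) else 0) T =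
        ∑ T ∈ A.powersetCard 2, (1 : k) := by
      rw [← Finset.sum_subset (Finset.subset_univ (A.powersetCard 2))]
      · refine Finset.sum_congr rfl fun T hT => ?_
        rw [Finset.mem_powersetCard] at hT
        rw [fA, if_pos hT.2, Finset.inter_eq_left.2 hT.1, if_pos hT.2]
      · intro T _ hT
        rw [fA]
        split_ifs with h3 h4
        · exfalso
          apply hT
          rw [Finset.mem_powersetCard]
          refine ⟨?_, h3⟩
          rw [← h3] at h4
          exact Finset.inter_eq_left.1 (Finset.eq_of_subset_of_card_le Finset.inter_subset_left h4.ge)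
        · rfl
        · rfl
    rw [this]
    simp only [Finset.sum_const, Finset.card_powersetCard, nsmul_eq_mul, mul_one]
    have : A.card.choose 2 = 2 * (t * (4 * t + 1)) := by
      rw [Nat.choose_two_right, ht]
      have : (4 * t + 1) * (4 * t + 1 - 1) = 2 * (2 * (t * (4 * t + 1))) := by
        rw [Nat.add_sub_cancel]; ring
      rw [this]; omega
    rw [this]
    push_cast
    rw [h2, zero_mul])
  simp at this
end


/-- Number of ordered pairs of equal entries. -/
def QL {κ : Type} [DecidableEq κ] : List κ → ℕ
  | [] => 0
  | c :: l => QL l + 2 * l.count c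

/-- Octahedral sums on lists. -/
def OOL {κ k : Type} [Field k] : List (κ × κ) → (List κ → k) → k
  | [], F => F []
  | (a, b) :: L, F => OOL L (fun T => F (a :: T) - F (b :: T))

section
variable {α κ k : Type} [DecidableEq α] [DecidableEq κ] [Field k]

/-- Number of ordered pairs of distinct points in the same fibre. -/
def qB (β : α → κ) (T : Finset α) : ℕ := (T.offDiag.filter (fun p => β p.1 = β p.2)).card

theorem qB_empty (β : α → κ) : qB β ∅ = 0 := by simp [qB]

theorem qB_insert (β : α → κ) (i : α) (R : Finset α) (hi : i ∉ R) :
    qB β (insert i R) = qB β R + 2 * (R.filter (fun r => β r = β i)).card := by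
  rw [qB, Finset.offDiag_insert hi, Finset.filter_union, Finset.filter_union,
    Finset.card_union_of_disjoint, Finset.card_union_of_disjoint, qB]
  · have e1 : (({i} : Finset α) ×ˢ R).filter (fun p => β p.1 = β p.2) =
        (R.filter (fun r => β r = β i)).image (fun r => (i, r)) := by
      ext ⟨x, y⟩
      simp only [Finset.mem_filter, Finset.mem_product, Finset.mem_singleton, Finset.mem_image,
        Prod.mk.injEq]
      constructor
      · rintro ⟨⟨rfl, h⟩, h2⟩; exact ⟨y, ⟨h, h2.symm⟩, rfl, rfl⟩
      · rintro ⟨r, ⟨h, h2⟩, rfl, rfl⟩; exact ⟨⟨rfl, h⟩, h2.symm⟩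
    have e2 : (R ×ˢ ({i} : Finset α)).filter (fun p => β p.1 = β p.2) =
        (R.filter (fun r => β r = β i)).image (fun r => (r, i)) := by
      ext ⟨x, y⟩
      simp only [Finset.mem_filter, Finset.mem_product, Finset.mem_singleton, Finset.mem_image,
        Prod.mk.injEq]
      constructor
      · rintro ⟨⟨h, rfl⟩, h2⟩; exact ⟨x, ⟨h, h2⟩, rfl, rfl⟩
      · rintro ⟨r, ⟨h, h2⟩, rfl, rfl⟩; exact ⟨⟨h, rfl⟩, h2⟩
    rw [e1, e2, Finset.card_image_of_injective _ (fun x y h => by simpa using h),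
      Finset.card_image_of_injective _ (fun x y h => by simpa using h)]
    ring
  · rw [Finset.disjoint_left]
    rintro ⟨x, y⟩ h1 h2
    simp only [Finset.mem_filter, Finset.mem_offDiag, Finset.mem_product, Finset.mem_singleton] at h1 h2
    apply hi
    rw [← h2.1.1]; exact h1.1.1
  · rw [Finset.disjoint_left]
    rintro ⟨x, y⟩ h1 h2
    simp only [Finset.mem_filter, Finset.mem_union, Finset.mem_offDiag, Finset.mem_product,
      Finset.mem_singleton] at h1 h2
    obtain ⟨⟨h3, h4⟩, h5⟩ := h2
    apply hi
    rcases h1 with h | h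
    · rw [← h4]; exact h.1.2.1
    · rw [← h4]; exact h.1.2

theorem qB_list (β : α → κ) (l : List α) (hl : l.Nodup) : qB β l.toFinset = QL (l.map β) := by
  induction l with
  | nil => simp [qB_empty, QL]
  | cons x l ih =>
    rw [List.nodup_cons] at hl
    rw [List.toFinset_cons, qB_insert _ _ _ (by simpa using hl.1), ih hl.2, List.map_cons, QL]
    congr 2
    have : (l.toFinset.filter (fun r => β r = β x)) = (l.filter (fun r => β r = β x)).toFinset := by
      ext y; simp
    rw [this, List.toFinset_card_of_nodup (hl.2.filter _), List.count, List.countP_map,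
      List.countP_eq_length_filter]
    congr 2

theorem qB_image (β : α → κ) (σ : Equiv.Perm α) (hσ : ∀ x y, β (σ x) = β (σ y) ↔ β x = β y)
    (T : Finset α) : qB β (T.image σ) = qB β T := by
  symm
  refine Finset.card_bij (fun p _ => (σ p.1, σ p.2)) ?_ ?_ ?_
  · rintro ⟨x, y⟩ h
    simp only [Finset.mem_filter, Finset.mem_offDiag] at h ⊢
    exact ⟨⟨Finset.mem_image_of_mem _ h.1.1, Finset.mem_image_of_mem _ h.1.2.1,
      fun e => h.1.2.2 (σ.injective e)⟩, (hσ _ _).2 h.2⟩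
  · rintro ⟨x, y⟩ _ ⟨x', y'⟩ _ h
    simp only [Prod.mk.injEq, EmbeddingLike.apply_eq_iff_eq] at h
    rw [h.1, h.2]
  · rintro ⟨x, y⟩ h
    simp only [Finset.mem_filter, Finset.mem_offDiag, Finset.mem_image] at h
    obtain ⟨⟨⟨x, hx, rfl⟩, ⟨y, hy, rfl⟩, hne⟩, h2⟩ := h
    refine ⟨(x, y), ?_, rfl⟩
    simp only [Finset.mem_filter, Finset.mem_offDiag]
    exact ⟨⟨hx, hy, fun e => hne (by rw [e])⟩, (hσ _ _).1 h2⟩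

/-- Set functions depending on the block type. -/
def fB (β : α → κ) (j : ℕ) (G : ℕ → k) (T : Finset α) : k :=
  if T.card = j then G (qB β T) else 0

theorem OO_list (β : α → κ) : ∀ (L : List (α × α)) (U : Finset α) (F : Finset α → k)
    (F' : List κ → k), Good U L →
    (∀ l : List α, l.Nodup → (∀ x ∈ l, x ∈ U) → l.length = L.length → F l.toFinset = F' (l.map β)) →
    OO L F = OOL (L.map (Prod.map β β)) F' := by
  intro L
  induction L with
  | nil =>
    intro U F F' _ h
    have := h [] (by simp) (by simp) rfl
    simpa [OO, OOL] using this
  | cons ab L ih =>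
    obtain ⟨a, b⟩ := ab
    intro U F F' hg h
    obtain ⟨ha, hb, hab, hg⟩ := hg
    simp only [List.map_cons, Prod.map_apply, OO, OOL]
    refine ih _ _ _ hg ?_
    intro l hl hlU hlen
    have haT : a ∉ l := fun h => by have := hlU _ h; simp at this
    have hbT : b ∉ l := fun h => by have := hlU _ h; simp at this
    have hTU : ∀ x ∈ l, x ∈ U := fun x hx =>
      Finset.mem_of_mem_erase (Finset.mem_of_mem_erase (hlU x hx))
    have e1 := h (a :: l) (List.nodup_cons.2 ⟨haT, hl⟩) (by simpa using ⟨ha, hTU⟩) (by simp [hlen])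
    have e2 := h (b :: l) (List.nodup_cons.2 ⟨hbT, hl⟩) (by simpa using ⟨hb, hTU⟩) (by simp [hlen])
    rw [List.toFinset_cons, List.map_cons] at e1 e2
    rw [e1, e2]

theorem good_of_nodup : ∀ (L : List (α × α)) (U : Finset α), (ptsL L).Nodup →
    (∀ x ∈ ptsL L, x ∈ U) → Good U L := by
  intro L
  induction L with
  | nil => intros; trivial
  | cons ab L ih =>
    obtain ⟨a, b⟩ := ab
    intro U h1 h2
    simp only [ptsL, List.nodup_cons, List.mem_cons, not_or] at h1 h2
    refine ⟨h2 a (by simp), h2 b (by simp), h1.1.1, ih _ h1.2.2 ?_⟩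
    intro x hx
    rw [Finset.mem_erase, Finset.mem_erase]
    refine ⟨?_, ?_, h2 x (by simp [hx])⟩
    · rintro rfl; exact h1.2.1 hx
    · rintro rfl; exact h1.1.2 hx

theorem OO_fB (β : α → κ) (j : ℕ) (G : ℕ → k) (L : List (α × α)) (U : Finset α) (hg : Good U L)
    (hl : L.length = j) :
    OO L (fB β j G) = OOL (L.map (Prod.map β β)) (fun l => G (QL l)) := by
  refine OO_list β L U _ _ hg ?_
  intro l hn _ hlen
  rw [fB, List.toFinset_card_of_nodup hn, if_pos (by rw [hlen, hl]), qB_list β l hn]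

variable [Fintype α]

theorem fB_top (β : α → κ) (a : ℕ) (ha : ∀ x, (Finset.univ.filter (fun y => β y = β x)).card = a)
    (j : ℕ) (G : ℕ → k) (R : Finset α) (hR : R.card + 1 = j) :
    ∑ T with R ⊆ T, fB β j G T =
      ∑ c ∈ R.image β, ((a : k) - (R.filter (fun r => β r = c)).card) *
        G (qB β R + 2 * (R.filter (fun r => β r = c)).card) +
      ((Fintype.card α : k) - (R.image β).card * a) * G (qB β R) := by
  rw [psi_top j _ (fun T hT => by rw [fB, if_neg hT]) R hR]
  have h1 : ∀ i ∈ Finset.univ.filter (fun i => i ∉ R), fB β j G (insert i R) =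
      G (qB β R + 2 * (R.filter (fun r => β r = β i)).card) := by
    intro i hi
    rw [Finset.mem_filter] at hi
    rw [fB, Finset.card_insert_of_notMem hi.2, if_pos hR, qB_insert _ _ _ hi.2]
  rw [Finset.sum_congr rfl h1,
    ← Finset.sum_filter_add_sum_filter_not _ (fun i => β i ∈ R.image β)]
  congr 1
  · rw [← Finset.sum_fiberwise_of_maps_to (t := R.image β) (g := β)
      (fun i hi => (Finset.mem_filter.1 hi).2)]
    refine Finset.sum_congr rfl fun c hc => ?_
    rw [Finset.sum_congr rfl (g := fun _ => G (qB β R + 2 * (R.filter (fun r => β r = c)).card))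
      (fun i hi => by rw [(Finset.mem_filter.1 hi).2]), Finset.sum_const, nsmul_eq_mul]
    congr 1
    obtain ⟨x, hx, rfl⟩ := Finset.mem_image.1 hc
    have e : ((Finset.univ.filter (fun i => i ∉ R)).filter (fun i => β i ∈ R.image β)).filter
        (fun i => β i = β x) =
        (Finset.univ.filter (fun y => β y = β x)) \ (R.filter (fun r => β r = β x)) := by
      ext i
      simp only [Finset.mem_filter, Finset.mem_univ, true_and, Finset.mem_sdiff]
      constructor
      · rintro ⟨⟨h1, h2⟩, h3⟩; exact ⟨h3, fun h => h1 h.1⟩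
      · rintro ⟨h1, h2⟩; exact ⟨⟨fun h => h2 ⟨h, h1⟩, by rw [h1]; exact hc⟩, h1⟩
    have hsub : (R.filter (fun r => β r = β x)) ⊆ (Finset.univ.filter (fun y => β y = β x)) :=
      Finset.filter_subset_filter _ (Finset.subset_univ _)
    rw [e, Finset.card_sdiff_of_subset hsub, Nat.cast_sub (Finset.card_le_card hsub), ha]
  · rw [Finset.sum_congr rfl (g := fun _ => G (qB β R)), Finset.sum_const, nsmul_eq_mul]
    · congr 1
      have e : (Finset.univ.filter (fun i => i ∉ R)).filter (fun i => β i ∉ R.image β) =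
          (Finset.univ.filter (fun i => β i ∈ R.image β))ᶜ := by
        ext i
        simp only [Finset.mem_filter, Finset.mem_univ, true_and, Finset.mem_compl]
        exact ⟨fun h => h.2, fun h => ⟨fun h2 => h (Finset.mem_image_of_mem _ h2), h⟩⟩
      have e2 : (Finset.univ.filter (fun i => β i ∈ R.image β)).card = (R.image β).card * a := by
        have hfib := Finset.card_eq_sum_card_fiberwise
          (s := Finset.univ.filter (fun i => β i ∈ R.image β)) (t := R.image β) (f := β)
          (fun i hi => by
            have hi' := (Finset.mem_filter.1 (Finset.mem_coe.1 hi)).2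
            exact Finset.mem_coe.2 hi')
        rw [hfib, Finset.sum_const_nat (m := a)]
        intro c hc
        obtain ⟨x, hx, rfl⟩ := Finset.mem_image.1 hc
        rw [← ha x]
        congr 1
        ext i
        simp only [Finset.mem_filter, Finset.mem_univ, true_and]
        exact ⟨fun h => h.2, fun h => ⟨by rw [h]; exact hc, h⟩⟩
      rw [e, Finset.card_compl, Nat.cast_sub (Finset.card_le_univ _), e2]
      push_cast
      rfl
    · intro i hi
      have : R.filter (fun r => β r = β i) = ∅ := by
        rw [Finset.filter_eq_empty_iff]
        intro x hx h
        exact (Finset.mem_filter.1 hi).2 (by rw [← h]; exact Finset.mem_image_of_mem _ hx)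
      rw [this]; rfl

theorem global_sum (j : ℕ) (f : Finset α → k) (hs : ∀ T, T.card ≠ j → f T = 0) (m : ℕ) :
    ∑ R ∈ Finset.univ.filter (fun R : Finset α => R.card = m), ∑ T with R ⊆ T, f T =
      (j.choose m : k) * ∑ T, f T := by
  simp only [Finset.sum_filter]
  have : ∀ R : Finset α, (if R.card = m then ∑ T : Finset α, (if R ⊆ T then f T else 0) else 0) =
      ∑ T : Finset α, if R ∈ T.powersetCard m then f T else 0 := by
    intro R
    split_ifs with h
    · refine Finset.sum_congr rfl fun T _ => ?_
      simp [Finset.mem_powersetCard, h]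
    · symm
      refine Finset.sum_eq_zero fun T _ => ?_
      rw [if_neg]
      rw [Finset.mem_powersetCard]
      exact fun h2 => h h2.2
  rw [Finset.sum_congr rfl fun R _ => this R, Finset.sum_comm, Finset.mul_sum]
  refine Finset.sum_congr rfl fun T _ => ?_
  rw [← Finset.sum_filter, Finset.sum_const, Finset.filter_mem_eq_inter, Finset.univ_inter,
    Finset.card_powersetCard, nsmul_eq_mul]
  by_cases hT : T.card = j
  · rw [hT]
  · rw [hs T hT]; simp

theorem lemJ_B {H : Subgroup ↥(alternatingGroup α)} (hKP : KP k H)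
    (htrans : ∀ a b : α, ∃ h ∈ H, (h : Equiv.Perm α) a = b)
    (β : α → κ) (hβ : ∀ h ∈ H, ∀ x y, β ((h : Equiv.Perm α) x) = β ((h : Equiv.Perm α) y) ↔ β x = β y)
    (hpair : ∃ x y, x ≠ y ∧ β x = β y)
    (hn : (Fintype.card α : k) ≠ 0) (j : ℕ) (hj : 1 ≤ j) (hjk : (j : k) ≠ 0) (hj4 : j ≤ 4)
    (hj4' : j = 4 → (2 : k) ≠ 0) (G : ℕ → k)
    (htop : ∀ R : Finset α, R.card + 1 = j → ∑ T with R ⊆ T, fB β j G T = 0)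
    (L : List (α × α)) (hL : (ptsL L).Nodup) (hlen : L.length = j) :
    OOL (L.map (Prod.map β β)) (fun l => G (QL l)) = 0 := by
  have hg : Good Finset.univ L := good_of_nodup L _ hL (by simp)
  rw [← OO_fB β j G L Finset.univ hg hlen]
  have hs : ∀ T : Finset α, T.card ≠ j → fB β j G T = 0 := fun T hT => by rw [fB, if_neg hT]
  have hinv : ∀ σ : Equiv.Perm α, (∀ x y, β (σ x) = β (σ y) ↔ β x = β y) →
      ∀ T, fB β j G (T.image σ) = fB β j G T := by
    intro σ hσ T
    rw [fB, fB, Finset.card_image_of_injective _ σ.injective, qB_image β σ hσ]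
  refine lemJ hKP j hj _ hs (fun h hh T => hinv _ (hβ h hh) T) ?_ ?_ L hg hlen
  · obtain ⟨x, y, hxy, hb⟩ := hpair
    refine ⟨Equiv.swap x y, Equiv.Perm.sign_swap hxy, fun T => hinv _ ?_ T⟩
    have : ∀ z, β (Equiv.swap x y z) = β z := by
      intro z
      rw [Equiv.swap_apply_def]
      split_ifs with h1 h2
      · rw [h1, hb]
      · rw [h2, hb]
      · rfl
    intro z w
    rw [this, this]
  · -- lower sums
    have h0 : ∑ T, fB β j G T = 0 := by
      have := global_sum j (fB β j G) hs (j - 1)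
      rw [Finset.sum_eq_zero] at this
      · have hc : j.choose (j - 1) = j := by
          obtain ⟨i, rfl⟩ : ∃ i, j = i + 1 := ⟨j - 1, by omega⟩
          rw [Nat.add_sub_cancel, Nat.choose_succ_self_right]
        rw [hc] at this
        exact (mul_eq_zero.1 this.symm).resolve_left hjk
      · intro R hR
        exact htop R (by rw [(Finset.mem_filter.1 hR).2]; omega)
    have hcst : ∀ x y : α, ∑ T with {x} ⊆ T, fB β j G T = ∑ T with {y} ⊆ T, fB β j G T := by
      intro x y
      obtain ⟨h, hh, hxy⟩ := htrans x y
      refine Finset.sum_bij (fun T _ => T.image (h : Equiv.Perm α)) ?_ ?_ ?_ ?_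
      · intro T hT
        simp only [Finset.mem_filter, Finset.mem_univ, true_and, Finset.singleton_subset_iff] at hT ⊢
        rw [← hxy]; exact Finset.mem_image_of_mem _ hT
      · intro T _ T' _ e
        exact Finset.image_injective (Equiv.injective _) e
      · intro T hT
        simp only [Finset.mem_filter, Finset.mem_univ, true_and, Finset.singleton_subset_iff] at hT
        refine ⟨T.image (h : Equiv.Perm α).symm, ?_, ?_⟩
        · simp only [Finset.mem_filter, Finset.mem_univ, true_and, Finset.singleton_subset_iff]
          refine Finset.mem_image.2 ⟨y, hT, ?_⟩
          rw [← hxy]; simp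
        · rw [Finset.image_image]; simp
      · intro T _
        exact (hinv _ (hβ h hh) T).symm
    have h1 : ∀ x : α, ∑ T with {x} ⊆ T, fB β j G T = 0 := by
      intro x
      have := psi_step j (fB β j G) hs ∅
      have e : ∑ i with i ∉ (∅ : Finset α), ∑ T with insert i ∅ ⊆ T, fB β j G T =
          ∑ i : α, ∑ T with {x} ⊆ T, fB β j G T := by
        refine Finset.sum_congr (by simp) fun i _ => ?_
        exact hcst i x
      rw [e] at this
      simp only [Finset.sum_const, Finset.card_univ, nsmul_eq_mul, Finset.empty_subset,
        Finset.filter_true, h0, mul_zero] at this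
      exact (mul_eq_zero.1 this).resolve_left hn
    intro R hR
    by_cases c0 : R.card = 0
    · rw [Finset.card_eq_zero] at c0
      subst c0
      simpa using h0
    by_cases c1 : R.card = 1
    · obtain ⟨x, rfl⟩ := Finset.card_eq_one.1 c1
      exact h1 x
    by_cases ct : R.card + 1 = j
    · exact htop R ct
    · have hj' : j = 4 := by omega
      refine psi_down j 2 _ hs htop ?_ R (by omega) hR
      intro m hm hm'
      have : m = 2 := by omega
      subst this
      subst hj'
      push_cast
      have := hj4' rfl
      intro h; apply this; linear_combination h
end


section
variable {α κ k : Type} [DecidableEq α] [DecidableEq κ] [Field k] [Fintype α]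

theorem top2 (β : α → κ) (a : ℕ) (ha : ∀ x, (Finset.univ.filter (fun y => β y = β x)).card = a)
    (G : ℕ → k) (h : ((a : k) - 1) * G 2 + ((Fintype.card α : k) - a) * G 0 = 0)
    (R : Finset α) (hR : R.card + 1 = 2) : ∑ T with R ⊆ T, fB β 2 G T = 0 := by
  rw [fB_top β a ha 2 G R hR]
  obtain ⟨x, rfl⟩ := Finset.card_eq_one.1 (show R.card = 1 by omega)
  have e1 : qB β ({x} : Finset α) = 0 := by
    have := qB_list β [x] (by simp)
    simpa [QL] using this
  rw [e1]
  simp [Finset.filter_singleton]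
  linear_combination h

theorem top3 (β : α → κ) (a : ℕ) (ha : ∀ x, (Finset.univ.filter (fun y => β y = β x)).card = a)
    (G : ℕ → k) (h : ((a : k) - 2) * G 6 + ((Fintype.card α : k) - a) * G 2 = 0)
    (h' : 2 * ((a : k) - 1) * G 2 + ((Fintype.card α : k) - 2 * a) * G 0 = 0)
    (R : Finset α) (hR : R.card + 1 = 3) : ∑ T with R ⊆ T, fB β 3 G T = 0 := by
  rw [fB_top β a ha 3 G R hR]
  obtain ⟨x, y, hxy, rfl⟩ := Finset.card_eq_two.1 (show R.card = 2 by omega)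
  have e1 : qB β ({x, y} : Finset α) = QL [β x, β y] := by
    have := qB_list β [x, y] (by simp [hxy])
    simpa using this
  rw [e1]
  by_cases hb : β x = β y
  · simp [hb, QL, Finset.filter_insert, Finset.filter_singleton, hxy]
    linear_combination h
  · have hb' : ¬ β y = β x := fun h => hb h.symm
    simp [hb, hb', QL, Finset.filter_insert, Finset.filter_singleton]
    linear_combination h'

theorem top4 (β : α → κ) (a : ℕ) (ha : ∀ x, (Finset.univ.filter (fun y => β y = β x)).card = a)
    (G : ℕ → k) (h : ((a : k) - 3) * G 12 + ((Fintype.card α : k) - a) * G 6 = 0)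
    (h' : ((a : k) - 2) * G 6 + ((a : k) - 1) * G 4 + ((Fintype.card α : k) - 2 * a) * G 2 = 0)
    (h'' : 3 * ((a : k) - 1) * G 2 + ((Fintype.card α : k) - 3 * a) * G 0 = 0 ∨
      (Fintype.card α = 2 * a))
    (R : Finset α) (hR : R.card + 1 = 4) : ∑ T with R ⊆ T, fB β 4 G T = 0 := by
  rw [fB_top β a ha 4 G R hR]
  obtain ⟨x, y, z, hxy, hxz, hyz, rfl⟩ := Finset.card_eq_three.1 (show R.card = 3 by omega)
  have e1 : qB β ({x, y, z} : Finset α) = QL [β x, β y, β z] := by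
    have := qB_list β [x, y, z] (by simp [hxy, hxz, hyz])
    simpa using this
  rw [e1]
  by_cases b1 : β x = β y
  · by_cases b2 : β x = β z
    · have b3 : β y = β z := b1 ▸ b2
      simp [b1, b3, QL, Finset.filter_insert, Finset.filter_singleton, hxy, hxz, hyz]
      linear_combination h
    · have b3 : ¬ β y = β z := b1 ▸ b2
      have b3' : ¬ β z = β y := fun h => b3 h.symm
      simp [b1, b3, b3', QL, Finset.filter_insert, Finset.filter_singleton, hxy, hxz, hyz]
      linear_combination h'
  · have b1' : ¬ β y = β x := fun h => b1 h.symm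
    by_cases b2 : β x = β z
    · have b3 : ¬ β y = β z := b2 ▸ b1'
      have b3' : ¬ β z = β y := fun h => b3 h.symm
      simp [b2, b3, b3', QL, Finset.filter_insert, Finset.filter_singleton, hxy, hxz, hyz]
      linear_combination h'
    · have b2' : ¬ β z = β x := fun h => b2 h.symm
      by_cases b3 : β y = β z
      · simp [b2, b2', b3, QL, Finset.filter_insert, Finset.filter_singleton, hxy, hxz, hyz]
        linear_combination h'
      · have b3' : ¬ β z = β y := fun h => b3 h.symm
        rcases h'' with h'' | h''
        · simp [b1, b1', b2, b2', b3, b3', QL, Finset.filter_insert, Finset.filter_singleton]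
          linear_combination h''
        · exfalso
          have hc : (Finset.univ.filter (fun i => β i ∈ ({x, y, z} : Finset α).image β)).card =
              3 * a := by
            have hfib := Finset.card_eq_sum_card_fiberwise
              (s := Finset.univ.filter (fun i => β i ∈ ({x, y, z} : Finset α).image β))
              (t := ({x, y, z} : Finset α).image β) (f := β)
              (fun i hi => by
                have hi' := (Finset.mem_filter.1 (Finset.mem_coe.1 hi)).2
                exact Finset.mem_coe.2 hi')
            rw [hfib, Finset.sum_const_nat (m := a)]
            · simp [b1, b2, b3]
            intro c hc
            obtain ⟨w, hw, rfl⟩ := Finset.mem_image.1 hc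
            rw [← ha w]
            congr 1
            ext i
            simp only [Finset.mem_filter, Finset.mem_univ, true_and]
            exact ⟨fun h => h.2, fun h => ⟨by rw [h]; exact hc, h⟩⟩
          have := Finset.card_le_univ (Finset.univ.filter
            (fun i => β i ∈ ({x, y, z} : Finset α).image β))
          have hapos : 0 < a := by
            rw [← ha x]; exact Finset.card_pos.2 ⟨x, by simp⟩
          omega

theorem exists_pts (β : α → κ) (a b : ℕ) (ha : ∀ x, (Finset.univ.filter (fun y => β y = β x)).card = a)
    (hab : Fintype.card α = a * b) (hpos : 0 < a) :
    ∃ (pt : Fin b → Fin a → α) (c : Fin b → κ), (∀ i j, β (pt i j) = c i) ∧ Function.Injective c ∧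
      (∀ i j i' j', pt i j = pt i' j' ↔ i = i' ∧ j = j') := by
  have hI : (Finset.univ.image β).card = b := by
    have := Finset.card_eq_sum_card_image β (Finset.univ : Finset α)
    rw [Finset.sum_const_nat (m := a), Finset.card_univ, hab, mul_comm] at this
    · exact (Nat.eq_of_mul_eq_mul_right hpos this).symm
    · intro c hc
      obtain ⟨x, _, rfl⟩ := Finset.mem_image.1 hc
      exact ha x
  let e := (Finset.equivFinOfCardEq hI).symm
  have hex : ∀ i : Fin b, ∃ x, β x = (e i : κ) := fun i => by
    obtain ⟨x, _, h⟩ := Finset.mem_image.1 (e i).2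
    exact ⟨x, h⟩
  choose r hr using hex
  let f : ∀ i : Fin b, Fin a ≃ (Finset.univ.filter (fun y => β y = β (r i))) := fun i =>
    (Finset.equivFinOfCardEq (ha (r i))).symm
  have hf : ∀ i j, β (f i j : α) = e i := fun i j => by
    rw [(Finset.mem_filter.1 (f i j).2).2, hr]
  have hc : Function.Injective (fun i => (e i : κ)) := fun i j h => e.injective (Subtype.ext h)
  refine ⟨fun i j => f i j, fun i => e i, hf, hc, ?_⟩
  intro i j i' j'
  constructor
  · intro h
    have : i = i' := hc (by simp only [← hf i j, ← hf i' j', h])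
    subst this
    exact ⟨rfl, (f i).injective (Subtype.ext h)⟩
  · rintro ⟨rfl, rfl⟩; rfl
end


section
variable {α κ k : Type} [DecidableEq α] [DecidableEq κ] [Field k] [Fintype α]

theorem impr_comb {H : Subgroup ↥(alternatingGroup α)} (hKP : KP k H)
    (htrans : ∀ a b : α, ∃ h ∈ H, (h : Equiv.Perm α) a = b)
    (β : α → κ) (hβ : ∀ h ∈ H, ∀ x y, β ((h : Equiv.Perm α) x) = β ((h : Equiv.Perm α) y) ↔ β x = β y)
    (hn : (Fintype.card α : k) ≠ 0) (a b : ℕ)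
    (ha : ∀ x, (Finset.univ.filter (fun y => β y = β x)).card = a)
    (hab : Fintype.card α = a * b) (ha2 : 2 ≤ a) (hb2 : 2 ≤ b) (hn5 : 5 ≤ Fintype.card α) :
    Fintype.card α = 6 ∧ (5 : k) = 0 := by
  obtain ⟨pt, c, hpt, hc, hinj⟩ := exists_pts β a b ha hab (by omega)
  have hpair : ∃ x y, x ≠ y ∧ β x = β y := by
    refine ⟨pt ⟨0, by omega⟩ ⟨0, by omega⟩, pt ⟨0, by omega⟩ ⟨1, by omega⟩, ?_, ?_⟩
    · simp [hinj]
    · simp [hpt]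
  have key := lemJ_B hKP htrans β hβ hpair hn
  have hcc : ∀ i j, c i = c j ↔ i = j := fun i j => hc.eq_iff
  have hnk : (Fintype.card α : k) = a * b := by rw [hab]; push_cast; rfl
  have ha0 : (a : k) ≠ 0 := fun h => hn (by rw [hnk, h, zero_mul])
  have hb0 : (b : k) ≠ 0 := fun h => hn (by rw [hnk, h, mul_zero])
  -- the octahedron for j = 3
  have oct3 : 3 ≤ a → 3 ≤ b → (3 : k) ≠ 0 → ∀ G : ℕ → k,
      ((a : k) - 2) * G 6 + ((Fintype.card α : k) - a) * G 2 = 0 →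
      2 * ((a : k) - 1) * G 2 + ((Fintype.card α : k) - 2 * a) * G 0 = 0 →
      G 6 - 3 * G 2 + 2 * G 0 = 0 := by
    intro ha3 hb3 h3 G h h'
    have := key 3 (by norm_num) (by exact_mod_cast h3) (by norm_num) (by norm_num) G
      (top3 β a ha G h h')
      [(pt ⟨0, by omega⟩ ⟨0, by omega⟩, pt ⟨1, by omega⟩ ⟨0, by omega⟩),
       (pt ⟨0, by omega⟩ ⟨1, by omega⟩, pt ⟨1, by omega⟩ ⟨1, by omega⟩),
       (pt ⟨0, by omega⟩ ⟨2, by omega⟩, pt ⟨2, by omega⟩ ⟨0, by omega⟩)]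
      (by simp [ptsL, hinj]) rfl
    simp [OOL, QL, hpt, hcc] at this
    linear_combination this
  by_cases h2 : (2 : k) = 0
  · exfalso
    have even0 : ∀ m : ℕ, m % 2 = 0 → (m : k) = 0 := by
      intro m hm
      obtain ⟨t, rfl⟩ : ∃ t, m = 2 * t := ⟨m / 2, by omega⟩
      push_cast; rw [h2, zero_mul]
    have odd1 : ∀ m : ℕ, (m : k) ≠ 0 → (m : k) = 1 ∧ m % 2 = 1 := by
      intro m hm
      rcases Nat.mod_two_eq_zero_or_one m with h | h
      · exact absurd (even0 m h) hm
      · refine ⟨?_, h⟩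
        obtain ⟨t, rfl⟩ : ∃ t, m = 2 * t + 1 := ⟨m / 2, by omega⟩
        push_cast; rw [h2, zero_mul, zero_add]
    have a1 := odd1 a ha0
    have b1 := odd1 b hb0
    have n1 := odd1 _ hn
    have h31 : (3 : k) = 1 := by linear_combination h2
    have := oct3 (by omega) (by omega) (by rw [h31]; exact one_ne_zero)
      (fun q => if q = 2 then 1 else 0) (by simp [a1.1, n1.1]) (by simp [a1.1])
    simp [h31] at this
  have j2 : ∀ G : ℕ → k, ((a : k) - 1) * G 2 + ((Fintype.card α : k) - a) * G 0 = 0 → G 2 = G 0 := by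
    intro G h
    have := key 2 (by norm_num) (by exact_mod_cast h2) (by norm_num) (by norm_num) G
      (top2 β a ha G h)
      [(pt ⟨0, by omega⟩ ⟨0, by omega⟩, pt ⟨1, by omega⟩ ⟨0, by omega⟩),
       (pt ⟨0, by omega⟩ ⟨1, by omega⟩, pt ⟨1, by omega⟩ ⟨1, by omega⟩)]
      (by simp [ptsL, hinj]) rfl
    simp [OOL, QL, hpt, hcc] at this
    have h3 : 2 * (G 2 - G 0) = 0 := by linear_combination this
    exact sub_eq_zero.1 ((mul_eq_zero.1 h3).resolve_left h2)
  have hn1 : (Fintype.card α : k) = 1 := by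
    have := j2 (fun q => if q = 2 then -((Fintype.card α : k) - a) else ((a : k) - 1))
      (by simp; ring)
    simp at this
    linear_combination this
  have ha1 : (a : k) - 1 ≠ 0 := by
    intro h
    have := j2 (fun q => if q = 2 then 1 else 0) (by simp [h])
    simp at this
  have h4 : (4 : ℕ) = 4 → (2 : k) ≠ 0 := fun _ => h2
  have h40 : ((4 : ℕ) : k) ≠ 0 := by
    intro h
    have : (2 : k) * 2 = 0 := by push_cast at h; linear_combination h
    exact h2 (by simpa using this)
  by_cases hbb : b = 2
  · subst hbb
    by_cases haa : a = 3
    · subst haa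
      refine ⟨by omega, ?_⟩
      rw [hab] at hn1
      push_cast at hn1
      linear_combination hn1
    · exfalso
      have h2a : (a : k) * 2 = 1 := by rw [← hn1, hnk]; norm_num
      have := key 4 (by norm_num) h40 le_rfl h4
        (fun q => if q = 12 then 1 else if q = 6 then 5 else if q = 4 then -15 else 0)
        (top4 β a ha _ (by simp [hn1]; linear_combination -2 * h2a)
          (by simp [hn1]; linear_combination -5 * h2a) (Or.inr (by omega)))
        [(pt ⟨0, by omega⟩ ⟨0, by omega⟩, pt ⟨1, by omega⟩ ⟨0, by omega⟩),
         (pt ⟨0, by omega⟩ ⟨1, by omega⟩, pt ⟨1, by omega⟩ ⟨1, by omega⟩),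
         (pt ⟨0, by omega⟩ ⟨2, by omega⟩, pt ⟨1, by omega⟩ ⟨2, by omega⟩),
         (pt ⟨0, by omega⟩ ⟨3, by omega⟩, pt ⟨1, by omega⟩ ⟨3, by omega⟩)]
        (by simp [ptsL, hinj]) rfl
      simp [OOL, QL, hpt, hcc] at this
      have h7 : (2 : k) ^ 7 = 0 := by linear_combination -this
      exact h2 (pow_eq_zero_iff (by norm_num) |>.1 h7)
  by_cases haa : a = 2
  · subst haa
    by_cases hb3 : b = 3
    · subst hb3
      refine ⟨by omega, ?_⟩
      rw [hab] at hn1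
      push_cast at hn1
      linear_combination hn1
    · exfalso
      have := key 4 (by norm_num) h40 le_rfl h4
        (fun q => if q = 4 then 15 else if q = 2 then 5 else if q = 0 then 3 else 0)
        (top4 β 2 ha _ (by simp)
          (by simp [hn1]; ring) (Or.inl (by simp [hn1]; ring)))
        [(pt ⟨0, by omega⟩ ⟨0, by omega⟩, pt ⟨2, by omega⟩ ⟨0, by omega⟩),
         (pt ⟨0, by omega⟩ ⟨1, by omega⟩, pt ⟨3, by omega⟩ ⟨0, by omega⟩),
         (pt ⟨1, by omega⟩ ⟨0, by omega⟩, pt ⟨2, by omega⟩ ⟨1, by omega⟩),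
         (pt ⟨1, by omega⟩ ⟨1, by omega⟩, pt ⟨3, by omega⟩ ⟨1, by omega⟩)]
        (by simp [ptsL, hinj]) rfl
      simp [OOL, QL, hpt, hcc] at this
      have h7 : (2 : k) ^ 4 = 0 := by linear_combination this
      exact h2 (pow_eq_zero_iff (by norm_num) |>.1 h7)
  exfalso
  by_cases h3 : (3 : k) = 0
  · have ha3 : (a : k) = 2 := by
      have mod3 : (a : k) = ((a % 3 : ℕ) : k) := by
        conv_lhs => rw [← Nat.div_add_mod a 3]
        push_cast; rw [h3]; ring
      have : a % 3 < 3 := Nat.mod_lt _ (by norm_num)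
      interval_cases h : a % 3
      · exfalso; exact ha0 (by simpa using mod3)
      · exfalso; exact ha1 (by rw [mod3]; simp)
      · simpa using mod3
    have ha5 : 4 ≤ a := by
      by_contra hlt
      have : a = 3 := by omega
      rw [this] at ha0
      exact ha0 (by exact_mod_cast h3)
    have := key 4 (by norm_num) h40 le_rfl h4
        (fun q => if q = 12 then 1 else if q = 6 then -1 else 0)
        (top4 β a ha _ (by simp [hn1, ha3]; ring)
          (by simp [ha3]) (Or.inl (by simp)))
        [(pt ⟨0, by omega⟩ ⟨0, by omega⟩, pt ⟨1, by omega⟩ ⟨0, by omega⟩),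
         (pt ⟨0, by omega⟩ ⟨1, by omega⟩, pt ⟨1, by omega⟩ ⟨1, by omega⟩),
         (pt ⟨0, by omega⟩ ⟨2, by omega⟩, pt ⟨2, by omega⟩ ⟨0, by omega⟩),
         (pt ⟨0, by omega⟩ ⟨3, by omega⟩, pt ⟨2, by omega⟩ ⟨1, by omega⟩)]
        (by simp [ptsL, hinj]) rfl
    simp [OOL, QL, hpt, hcc] at this
    have h7 : (2 : k) = 0 := by linear_combination this - h3
    exact h2 h7
  · have := oct3 (by omega) (by omega) h3
      (fun q => if q = 6 then ((a:k) - 1) * (2 * a - 1) else if q = 2 then ((a:k) - 2) * (2 * a - 1)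
        else 2 * ((a:k) - 1) * (a - 2)) (by simp [hn1]; ring) (by simp [hn1]; ring)
    simp at this
    exact h3 (by linear_combination this)
end


section
open Equiv

/-- Even permutations of six points preserving the partition into intervals of length `a`. -/
def Wr (a : ℕ) : Subgroup ↥(alternatingGroup (Fin 6)) where
  carrier := {g | ∀ x y : Fin 6, ((g : Perm (Fin 6)) x).val / a = ((g : Perm (Fin 6)) y).val / a ↔
    x.val / a = y.val / a}
  one_mem' := by intro x y; simp
  mul_mem' := by
    intro g h hg hh x y
    rw [Subgroup.coe_mul, Perm.mul_apply, Perm.mul_apply, hg, hh]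
  inv_mem' := by
    intro g hg x y
    rw [← hg, Subgroup.coe_inv]
    simp

theorem mem_Wr (a : ℕ) (g : ↥(alternatingGroup (Fin 6))) : g ∈ Wr a ↔
   ∀ x y : Fin 6, ((g : Perm (Fin 6)) x).val / a = ((g : Perm (Fin 6)) y).val / a ↔
    x.val / a = y.val / a := Iff.rfl

theorem card_sub_alt {n : ℕ} (H : Subgroup ↥(alternatingGroup (Fin n))) (P : Perm (Fin n) → Prop)
    [DecidablePred P]
    (h : ∀ g : ↥(alternatingGroup (Fin n)), g ∈ H ↔ P g) :
    Nat.card H = (Finset.univ.filter (fun g : Perm (Fin n) => P g ∧ Perm.sign g = 1)).card := by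
  rw [← Fintype.card_subtype, ← Nat.card_eq_fintype_card]
  refine Nat.card_congr
    { toFun := fun g => ⟨g.1.1, (h _).1 g.2, Perm.mem_alternatingGroup.1 g.1.2⟩
      invFun := fun g => ⟨⟨g.1, Perm.mem_alternatingGroup.2 g.2.2⟩, (h _).2 g.2.1⟩
      left_inv := fun _ => rfl
      right_inv := fun _ => rfl }

set_option maxRecDepth 100000 in
theorem card_Wr3 : Nat.card (Wr 3) = 36 := by
  rw [card_sub_alt _ (fun g : Perm (Fin 6) => ∀ x y : Fin 6, (g x).val / 3 = (g y).val / 3 ↔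
    x.val / 3 = y.val / 3) (mem_Wr 3)]
  decide +kernel

set_option maxRecDepth 100000 in
theorem card_Wr2 : Nat.card (Wr 2) = 24 := by
  rw [card_sub_alt _ (fun g : Perm (Fin 6) => ∀ x y : Fin 6, (g x).val / 2 = (g y).val / 2 ↔
    x.val / 2 = y.val / 2) (mem_Wr 2)]
  decide +kernel

/-- A 3-cycle. -/
def cc : ↥(alternatingGroup (Fin 6)) := ⟨c[0, 1, 2], Perm.mem_alternatingGroup.2 (by decide +kernel)⟩
/-- Another 3-cycle. -/
def dd : ↥(alternatingGroup (Fin 6)) := ⟨c[3, 4, 5], Perm.mem_alternatingGroup.2 (by decide +kernel)⟩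
/-- An element of order four. -/
def tt : ↥(alternatingGroup (Fin 6)) := ⟨c[0, 3, 1, 4] * c[2, 5], Perm.mem_alternatingGroup.2 (by decide +kernel)⟩

set_option maxRecDepth 100000 in
/-- The elementary abelian group of order nine. -/
def psi9 : Multiplicative (ZMod 3) × Multiplicative (ZMod 3) →* ↥(alternatingGroup (Fin 6)) where
  toFun x := cc ^ (ZMod.val (Multiplicative.toAdd x.1)) * dd ^ (ZMod.val (Multiplicative.toAdd x.2))
  map_one' := by decide +kernel
  map_mul' := by decide +kernel

set_option maxRecDepth 100000 in
theorem psi9_inj : Function.Injective psi9 := by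
  rw [injective_iff_map_eq_one]
  decide +kernel

theorem card_K9 : Nat.card psi9.range = 9 := by
  rw [Nat.card_congr (MonoidHom.ofInjective psi9_inj).symm.toEquiv]
  simp

set_option maxRecDepth 100000 in
theorem psi9_Wr : psi9.range ≤ Wr 3 := by
  rintro _ ⟨x, rfl⟩
  rw [mem_Wr]
  revert x
  decide +kernel

set_option maxRecDepth 100000 in
theorem psi9_normal_aux : ∀ g : Perm (Fin 6), (∀ x y : Fin 6, (g x).val / 3 = (g y).val / 3 ↔
    x.val / 3 = y.val / 3) → ∀ x, ∃ y, g * (psi9 x : Perm (Fin 6)) * g⁻¹ = psi9 y := by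
  decide +kernel

set_option maxRecDepth 100000 in
theorem tt_Wr : tt ∈ Wr 3 := by
  rw [mem_Wr]
  decide +kernel

set_option maxRecDepth 100000 in
theorem order_tt : orderOf tt = 4 := by
  have := orderOf_eq_prime_pow (p := 2) (n := 1) (x := tt) (by decide +kernel) (by decide +kernel)
  simpa using this

set_option maxRecDepth 100000 in
theorem K9_aux : ∀ g : Perm (Fin 6), (∀ x : Fin 6, (g x).val / 3 = x.val / 3) → Perm.sign g = 1 →
    g * g = 1 ∨ ∃ y, g = psi9 y := by
  decide +kernel

theorem Wr3_struct : ∃ N C : Subgroup (Wr 3), N.Normal ∧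
      Nonempty (↥N ≃* (Multiplicative (ZMod 3) × Multiplicative (ZMod 3))) ∧
      IsCyclic ↥C ∧ Nat.card C = 4 ∧ N ⊓ C = ⊥ ∧ N ⊔ C = ⊤ := by
  have hC : Nat.card (Subgroup.zpowers (⟨tt, tt_Wr⟩ : Wr 3)) = 4 := by
    rw [Nat.card_zpowers, Subgroup.orderOf_mk, order_tt]
  have hN : Nat.card (psi9.range.subgroupOf (Wr 3)) = 9 := by
    rw [Nat.card_congr (Subgroup.subgroupOfEquivOfLe psi9_Wr).toEquiv, card_K9]
  have hc := Subgroup.isComplement'_of_coprime (H := psi9.range.subgroupOf (Wr 3))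
    (K := Subgroup.zpowers (⟨tt, tt_Wr⟩ : Wr 3)) (by rw [hN, hC, card_Wr3]) (by rw [hN, hC]; decide)
  refine ⟨psi9.range.subgroupOf (Wr 3), Subgroup.zpowers ⟨tt, tt_Wr⟩, ?_, ?_, inferInstance, hC, ?_,
    hc.sup_eq_top⟩
  · constructor
    rintro n hn g
    rw [Subgroup.mem_subgroupOf] at hn ⊢
    obtain ⟨x, hx⟩ := hn
    obtain ⟨y, hy⟩ := psi9_normal_aux g.1.1 g.2 x
    refine ⟨y, ?_⟩
    apply Subtype.ext
    rw [← hy, hx]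
    rfl
  · exact ⟨(Subgroup.subgroupOfEquivOfLe psi9_Wr).trans (MonoidHom.ofInjective psi9_inj).symm⟩
  · exact hc.disjoint.eq_bot

theorem card_A6 : Nat.card ↥(alternatingGroup (Fin 6)) = 360 := by
  rw [nat_card_alternatingGroup, Nat.card_eq_fintype_card, Fintype.card_fin]; rfl

theorem index_of_card {n m i : ℕ} (H : Subgroup ↥(alternatingGroup (Fin n))) (h : Nat.card H = m)
    (hA : Nat.card ↥(alternatingGroup (Fin n)) = m * i) (hm : 0 < m) : H.index = i := by
  have := H.card_mul_index
  rw [h, hA] at this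
  exact Nat.eq_of_mul_eq_mul_left hm this

theorem tab5 (H : Subgroup ↥(alternatingGroup (Fin 6))) (e : Wr 3 ≃* H) : AltTable 6 5 H := by
  have hcard : Nat.card H = 36 := by rw [← Nat.card_congr e.toEquiv, card_Wr3]
  refine Or.inr <| Or.inr <| Or.inr <| Or.inr <| Or.inl ⟨rfl, rfl, hcard, ?_,
    index_of_card H hcard card_A6 (by norm_num)⟩
  obtain ⟨N, C, h1, ⟨h2⟩, h3, h4, h5, h6⟩ := Wr3_struct
  have einj : Function.Injective e.toMonoidHom := e.injective
  refine ⟨N.map e.toMonoidHom, C.map e.toMonoidHom, h1.map _ e.surjective, ⟨?_⟩, ?_, ?_, ?_, ?_⟩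
  · exact (N.equivMapOfInjective _ einj).symm.trans h2
  · exact isCyclic_of_surjective (C.equivMapOfInjective _ einj) (MulEquiv.surjective _)
  · rw [Subgroup.card_map_of_injective einj, h4]
  · rw [← Subgroup.map_inf _ _ _ einj, h5, Subgroup.map_bot]
  · rw [← Subgroup.map_sup, h6, ← MonoidHom.range_eq_map]
    exact MonoidHom.range_eq_top.2 e.surjective

theorem tab4 (H : Subgroup ↥(alternatingGroup (Fin 6))) (e : psi9.range ≃* H) : AltTable 6 2 H := by
  have hcard : Nat.card H = 9 := by rw [← Nat.card_congr e.toEquiv, card_K9]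
  exact Or.inr <| Or.inr <| Or.inr <| Or.inl ⟨rfl, rfl,
    ⟨e.symm.trans (MonoidHom.ofInjective psi9_inj).symm⟩,
    index_of_card H hcard card_A6 (by norm_num)⟩
end


section
open Equiv

theorem n_dvd {n : ℕ} [NeZero n] (H : Subgroup ↥(alternatingGroup (Fin n)))
    (htrans : ∀ a b : Fin n, ∃ h ∈ H, (h : Perm (Fin n)) a = b) : n ∣ Nat.card H := by
  classical
  have h1 := MulAction.card_orbit_mul_card_stabilizer_eq_card_group ↥H (0 : Fin n)
  have h2 : MulAction.orbit ↥H (0 : Fin n) = Set.univ := by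
    rw [Set.eq_univ_iff_forall]
    intro x
    obtain ⟨h, hh, e⟩ := htrans 0 x
    exact ⟨⟨h, hh⟩, e⟩
  rw [Nat.card_eq_fintype_card, ← h1]
  have h3 : Fintype.card (MulAction.orbit ↥H (0 : Fin n)) = n := by
    rw [← Nat.card_eq_fintype_card, h2]; simp
  rw [h3]
  exact dvd_mul_right _ _

/-- Pulling back a subgroup along an isomorphism. -/
noncomputable def comapEquiv {L G : Type} [Group L] [Group G] (φ : L ≃* G) (H : Subgroup G) :
    H.comap φ.toMonoidHom ≃* H :=
  MulEquiv.ofBijective (φ.toMonoidHom.subgroupComap H)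
    ⟨fun _ _ h => Subtype.ext (φ.injective (congrArg Subtype.val h)), fun y =>
      ⟨⟨φ.symm y.1, by rw [Subgroup.mem_comap]; simp⟩, Subtype.ext (φ.apply_symm_apply y.1)⟩⟩

theorem block_fun {n : ℕ} (H : Subgroup ↥(alternatingGroup (Fin n)))
    (htrans : ∀ a b : Fin n, ∃ h ∈ H, (h : Perm (Fin n)) a = b)
    (B : Set (Fin n)) (hB : ∀ h : ↥(alternatingGroup (Fin n)), h ∈ H →
        (h : Perm (Fin n)) '' B = B ∨ Disjoint ((h : Perm (Fin n)) '' B) B)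
    (b0 : Fin n) (hb0 : b0 ∈ B) :
    ∃ β : Fin n → Set (Fin n), (∀ h ∈ H, ∀ x, β ((h : Perm (Fin n)) x) = (h : Perm (Fin n)) '' β x) ∧
      (∀ x y, β x = β y ↔ y ∈ β x) ∧ (∀ x, (β x).ncard = B.ncard) := by
  choose s hs hsx using fun x => htrans b0 x
  -- translates are equal or disjoint
  have key : ∀ g ∈ H, ∀ h ∈ H, ∀ x, x ∈ (g : Perm (Fin n)) '' B → x ∈ (h : Perm (Fin n)) '' B →
      (g : Perm (Fin n)) '' B = (h : Perm (Fin n)) '' B := by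
    intro g hg h hh x hxg hxh
    rcases hB (h⁻¹ * g) (H.mul_mem (H.inv_mem hh) hg) with h1 | h1
    · have : (h : Perm (Fin n)) '' (((h⁻¹ * g : ↥(alternatingGroup (Fin n))) : Perm (Fin n)) '' B) =
          (h : Perm (Fin n)) '' B := by rw [h1]
      rw [← this, Set.image_image]
      simp
    · exfalso
      rw [Set.disjoint_left] at h1
      obtain ⟨y, hy, rfl⟩ := hxg
      obtain ⟨z, hz, hzy⟩ := hxh
      refine h1 (a := z) ⟨y, hy, ?_⟩ hz
      simp [← hzy]
  have mem : ∀ x, x ∈ ((s x : Perm (Fin n)) '' B) := fun x => ⟨b0, hb0, hsx x⟩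
  refine ⟨fun x => (s x : Perm (Fin n)) '' B, ?_, ?_, ?_⟩
  · intro h hh x
    have := key (s ((h : Perm (Fin n)) x)) (hs _) (h * s x) (H.mul_mem hh (hs _))
      ((h : Perm (Fin n)) x) (mem _) ⟨b0, hb0, by simp [hsx]⟩
    simp only [this, Set.image_image]
    rfl
  · intro x y
    constructor
    · intro h
      change (s x : Perm (Fin n)) '' B = (s y : Perm (Fin n)) '' B at h
      change y ∈ (s x : Perm (Fin n)) '' B
      rw [h]; exact mem y
    · intro h
      exact key _ (hs x) _ (hs y) y h (mem y)
  · intro x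
    exact Set.ncard_image_of_injective _ (Equiv.injective _)

theorem impr_final {k : Type} [Field k] {p : ℕ} [Fact p.Prime] [CharP k p] {n : ℕ} (hn : 5 ≤ n)
    (H : Subgroup ↥(alternatingGroup (Fin n))) (hIp : HasIp k p H)
    (htrans : ∀ a b : Fin n, ∃ h ∈ H, (h : Perm (Fin n)) a = b)
    (B : Set (Fin n)) (hB : ∀ h : ↥(alternatingGroup (Fin n)), h ∈ H →
        (h : Perm (Fin n)) '' B = B ∨ Disjoint ((h : Perm (Fin n)) '' B) B)
    (hB1 : ¬ B.Subsingleton) (hB2 : B ≠ Set.univ) : AltTable n p H := by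
  classical
  have hKP := KP_of_hasIp hIp
  have : NeZero n := ⟨by omega⟩
  have hnk : ((Fintype.card (Fin n) : ℕ) : k) ≠ 0 := by
    rw [Fintype.card_fin, Ne, CharP.cast_eq_zero_iff k p]
    exact fun h => hIp.1 (h.trans (n_dvd H htrans))
  rw [Set.not_subsingleton_iff] at hB1
  obtain ⟨b0, hb0, b1, hb1, hb⟩ := hB1
  obtain ⟨β, hβ1, hβ2, hβ3⟩ := block_fun H htrans B hB b0 hb0
  have ha : ∀ x, (Finset.univ.filter (fun y => β y = β x)).card = B.ncard := by
    intro x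
    rw [← hβ3 x, ← Set.ncard_coe_finset]
    congr 1
    ext y
    simp only [Finset.coe_filter, Finset.mem_univ, true_and, Set.mem_ofPred_eq]
    rw [eq_comm, hβ2]
  have ha2 : 2 ≤ B.ncard := by
    rw [← Set.ncard_pair hb]
    exact Set.ncard_le_ncard (by intro x hx; rcases hx with rfl | rfl <;> assumption)
  have haln : B.ncard < n := by
    have := Set.ncard_lt_ncard (Set.ssubset_univ_iff.2 hB2)
    simpa [Set.ncard_univ] using this
  have hab : Fintype.card (Fin n) = B.ncard * (Finset.univ.image β).card := by
    have := Finset.card_eq_sum_card_image β (Finset.univ : Finset (Fin n))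
    rw [Finset.sum_const_nat (m := B.ncard), Finset.card_univ, mul_comm] at this
    · exact this
    · intro c hc
      obtain ⟨x, _, rfl⟩ := Finset.mem_image.1 hc
      exact ha x
  set a := B.ncard with had
  set b := (Finset.univ.image β).card with hbd
  have hb2 : 2 ≤ b := by
    by_contra hlt
    rw [Fintype.card_fin] at hab
    interval_cases b <;> omega
  have hβ : ∀ h ∈ H, ∀ x y, β ((h : Perm (Fin n)) x) = β ((h : Perm (Fin n)) y) ↔ β x = β y := by
    intro h hh x y
    rw [hβ1 h hh, hβ1 h hh]
    exact (Set.image_injective.2 (Equiv.injective _)).eq_iff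
  obtain ⟨hn6, h5⟩ := impr_comb hKP htrans β hβ hnk a b ha hab ha2 hb2 (by simpa using hn)
  have hp5 : p = 5 := by
    have : ((5 : ℕ) : k) = 0 := by exact_mod_cast h5
    rw [CharP.cast_eq_zero_iff k p] at this
    exact (Nat.prime_dvd_prime_iff_eq Fact.out (by norm_num)).1 this
  have hn6' : n = 6 := by simpa using hn6
  subst hn6'
  subst hp5
  obtain ⟨pt, c, hpt, hc, hinj⟩ := exists_pts β a b ha hab (by omega)
  have habn : a * b = 6 := by rw [← hab]; simp
  -- the relabelling
  let f0 : Fin 6 → Fin 6 := fun x => pt ⟨x.val / a, by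
      have := x.2; exact (Nat.div_lt_iff_lt_mul (by omega)).2 (by rw [mul_comm, habn]; exact this)⟩
    ⟨x.val % a, Nat.mod_lt _ (by omega)⟩
  have f0inj : Function.Injective f0 := by
    intro x y h
    simp only [f0, hinj, Fin.mk.injEq] at h
    apply Fin.ext
    rw [← Nat.div_add_mod x.val a, ← Nat.div_add_mod y.val a, h.1, h.2]
  have f0β : ∀ x y, β (f0 x) = β (f0 y) ↔ x.val / a = y.val / a := by
    intro x y
    simp only [f0, hpt, hc.eq_iff, Fin.mk.injEq]
  let f : Fin 6 ≃ Fin 6 := Equiv.ofBijective f0 (Finite.injective_iff_bijective.1 f0inj)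
  let φ := Equiv.altCongrHom f
  have hsub := hKP.sub hIp.1 φ.toMonoidHom φ.injective (by
    rw [MonoidHom.range_eq_top.2 (show Function.Surjective φ.toMonoidHom from φ.surjective)]
    exact le_top)
  set H' := H.comap φ.toMonoidHom with hH'
  have hle : H' ≤ Wr a := by
    intro g hg
    rw [hH', Subgroup.mem_comap] at hg
    rw [mem_Wr]
    intro x y
    rw [← f0β, ← f0β]
    have := hβ _ hg (f0 x) (f0 y)
    rw [← this]
    have e : ∀ z, ((φ g : ↥(alternatingGroup (Fin 6))) : Perm (Fin 6)) (f0 z) = f0 ((g : Perm (Fin 6)) z) := by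
      intro z
      have : f.symm (f0 z) = z := f.symm_apply_apply z
      simp [φ, Equiv.permCongr_apply, this]
      rfl
    have e' : ∀ z, ((φ.toMonoidHom g : ↥(alternatingGroup (Fin 6))) : Perm (Fin 6)) (f0 z) =
      f0 ((g : Perm (Fin 6)) z) := e
    rw [e', e']
  have hKP' := KP_of_hasIp hsub
  have hord := hKP'.order (p := 5) (Wr 3) (by rw [card_Wr3]; decide)
  have haa : a = 2 ∨ a = 3 := by
    have : a ≤ 3 := by nlinarith
    omega
  rcases haa with haa | haa
  · exfalso
    rw [haa] at hle
    have := Subgroup.card_le_of_le hle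
    rw [card_Wr2] at this
    rw [card_Wr3] at hord
    omega
  · rw [haa] at hle
    have hHW := hKP'.max (p := 5) (Wr 3) (by rw [card_Wr3]; decide) hle
    apply tab5
    rw [← hHW, hH']
    exact comapEquiv φ H
end


section
open Equiv

theorem relabel {κ : Type} [DecidableEq κ] (β : Fin 6 → κ) (a b : ℕ)
    (ha : ∀ x, (Finset.univ.filter (fun y => β y = β x)).card = a) (habn : a * b = 6)
    (hpos : 0 < a) :
    ∃ f : Fin 6 ≃ Fin 6, ∀ x y, β (f x) = β (f y) ↔ x.val / a = y.val / a := by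
  obtain ⟨pt, c, hpt, hc, hinj⟩ := exists_pts β a b ha (by rw [habn]; simp) hpos
  let f0 : Fin 6 → Fin 6 := fun x => pt ⟨x.val / a, by
      have := x.2; exact (Nat.div_lt_iff_lt_mul (by omega)).2 (by rw [mul_comm, habn]; exact this)⟩
    ⟨x.val % a, Nat.mod_lt _ (by omega)⟩
  have f0inj : Function.Injective f0 := by
    intro x y h
    simp only [f0, hinj, Fin.mk.injEq] at h
    apply Fin.ext
    rw [← Nat.div_add_mod x.val a, ← Nat.div_add_mod y.val a, h.1, h.2]
  refine ⟨Equiv.ofBijective f0 (Finite.injective_iff_bijective.1 f0inj), ?_⟩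
  intro x y
  simp only [f0, hpt, hc.eq_iff, Fin.mk.injEq, Equiv.ofBijective_apply]

theorem altCongr_apply' {n : ℕ} (f : Fin n ≃ Fin n) (g : ↥(alternatingGroup (Fin n))) (z : Fin n) :
    ((f.altCongrHom.toMonoidHom g : ↥(alternatingGroup (Fin n))) : Perm (Fin n)) (f z) =
      f ((g : Perm (Fin n)) z) := by
  change ((f.altCongrHom g : ↥(alternatingGroup (Fin n))) : Perm (Fin n)) (f z) = _
  simp

theorem sub_congr {k : Type} [Field k] {p : ℕ} {n : ℕ} {H : Subgroup ↥(alternatingGroup (Fin n))}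
    (hKP : KP k H) (hp : ¬ p ∣ Nat.card H) (f : Fin n ≃ Fin n) :
    HasIp k p (H.comap f.altCongrHom.toMonoidHom) := by
  refine hKP.sub hp f.altCongrHom.toMonoidHom f.altCongrHom.injective ?_
  rw [MonoidHom.range_eq_top.2
    (show Function.Surjective f.altCongrHom.toMonoidHom from f.altCongrHom.surjective)]
  exact le_top

/-- `n = 6`, `p = 2`, two orbits of length three. -/
theorem case33 {k : Type} [Field k] [CharP k 2]
    (H : Subgroup ↥(alternatingGroup (Fin 6))) (hIp : HasIp k 2 H)
    (A : Finset (Fin 6)) (hA : ∀ h ∈ H, A.image (h : Perm (Fin 6)) = A) (hA3 : A.card = 3) :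
    AltTable 6 2 H := by
  classical
  have hKP := KP_of_hasIp hIp
  have hmem : ∀ h ∈ H, ∀ x, (h : Perm (Fin 6)) x ∈ A ↔ x ∈ A := by
    intro h hh x
    conv_lhs => rw [← hA h hh]
    simp
  obtain ⟨f, hf⟩ := relabel (fun x => decide (x ∈ A)) 3 2 (by
    intro x
    by_cases hx : x ∈ A
    · simp [hx, hA3]
    · have : (Finset.univ.filter (fun y => y ∉ A)) = Aᶜ := by ext; simp
      simp [hx, this, Finset.card_compl, hA3]) rfl (by norm_num)
  have hIp' := sub_congr hKP hIp.1 f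
  have hKP' := KP_of_hasIp hIp'
  have hle : H.comap f.altCongrHom.toMonoidHom ≤ psi9.range := by
    intro g hg
    have hg' : ∀ x : Fin 6, ((g : Perm (Fin 6)) x).val / 3 = x.val / 3 := by
      intro x
      rw [← hf, ← altCongr_apply']
      simp only [decide_eq_decide]
      exact hmem _ hg _
    rcases K9_aux g hg' (Perm.mem_alternatingGroup.1 g.2) with h | ⟨y, hy⟩
    · have h2 : g ^ 2 = 1 := by rw [pow_two]; exact Subtype.ext h
      have h3 : orderOf g ∣ 2 := orderOf_dvd_of_pow_eq_one h2
      rcases (Nat.dvd_prime Nat.prime_two).1 h3 with h4 | h4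
      · rw [orderOf_eq_one_iff] at h4
        rw [h4]; exact one_mem _
      · exfalso
        apply hIp'.1
        rw [← h4]
        exact Subgroup.orderOf_dvd_natCard _ hg
    · exact ⟨y, Subtype.ext hy.symm⟩
  have heq := hKP'.max (p := 2) psi9.range (by rw [card_K9]; decide) hle
  apply tab4
  rw [← heq]
  exact comapEquiv f.altCongrHom H

/-- The standard five-cycle. -/
def c5 : Perm (Fin 6) := c[0, 1, 2, 3, 4]

/-- The Paley function. -/
def FF (x : Fin 6 × Fin 6) : ℤ :=
  if x.1 = 5 ∨ x.2 = 5 ∨ x.1 = x.2 then 0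
  else if x.1 = c5 x.2 ∨ x.2 = c5 x.1 then 1 else -1

set_option maxRecDepth 100000 in
theorem c5_label : ∀ g : Perm (Fin 6), g ^ 5 = 1 → g ≠ 1 → ∃ x y : Fin 6,
    Function.Injective (fun i : Fin 6 => if i = 5 then x else (g ^ i.val) y) ∧
    ∀ i : Fin 6, g (if i = 5 then x else (g ^ i.val) y) =
      (if c5 i = 5 then x else (g ^ (c5 i).val) y) := by
  decide +kernel

set_option maxRecDepth 100000 in
theorem FF_inv : ∀ g : Perm (Fin 6), (g * c5 = c5 * g ∨ g * c5 = c5⁻¹ * g) →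
    ∀ x : Fin 6 × Fin 6, FF (g x.1, g x.2) = FF x := by
  decide +kernel

/-- Rotation. -/
def r8 : ↥(alternatingGroup (Fin 6)) :=
  ⟨c[1, 2, 4, 3] * c[0, 5], Perm.mem_alternatingGroup.2 (by decide +kernel)⟩
/-- Reflection. -/
def s8 : ↥(alternatingGroup (Fin 6)) :=
  ⟨c[1, 4] * c[0, 5], Perm.mem_alternatingGroup.2 (by decide +kernel)⟩

/-- The dihedral group of order eight. -/
def g8 (i : Fin 4 × Fin 2) : ↥(alternatingGroup (Fin 6)) := r8 ^ i.1.val * s8 ^ i.2.val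

set_option maxRecDepth 100000 in
theorem FF_sum : ∀ x : Fin 6 × Fin 6,
    ∑ i, FF ((((g8 i)⁻¹ : ↥(alternatingGroup (Fin 6))) : Perm (Fin 6)) x.1,
      (((g8 i)⁻¹ : ↥(alternatingGroup (Fin 6))) : Perm (Fin 6)) x.2) = 0 := by
  decide +kernel

theorem caseD5 {k : Type} [Field k] [CharP k 3]
    (H : Subgroup ↥(alternatingGroup (Fin 6))) (hIp : HasIp k 3 H)
    (c : ↥(alternatingGroup (Fin 6))) (h5 : c ^ 5 = 1) (h1 : c ≠ 1)
    (hcH : ∀ h ∈ H, h * c = c * h ∨ h * c = c⁻¹ * h) : False := by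
  classical
  have hKP := KP_of_hasIp hIp
  obtain ⟨x, y, hinj, hlab⟩ := c5_label c (by exact_mod_cast congrArg Subtype.val h5)
    (fun h => h1 (Subtype.ext h))
  let f : Fin 6 ≃ Fin 6 := Equiv.ofBijective _ (Finite.injective_iff_bijective.1 hinj)
  have hfc : ∀ i, (c : Perm (Fin 6)) (f i) = f (c5 i) := hlab
  have hfc' : ∀ i, (c⁻¹ : Perm (Fin 6)) (f i) = f (c5⁻¹ i) := by
    intro i
    rw [Perm.inv_eq_iff_eq, hfc]
    simp
  have hKP' := KP_of_hasIp (sub_congr hKP hIp.1 f)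
  have hz := hKP'.family g8 (fun _ => (1 : k)) (fnRep k ↥(alternatingGroup (Fin 6)) (Fin 6 × Fin 6))
    (fun x => (FF x : k)) ?_ ?_ ?_
  · have := congrFun hz (0, 1)
    have e : FF (0, 1) = 1 := by decide +kernel
    simp [e] at this
  · intro h hh
    have hcomm : (h : Perm (Fin 6)) * c5 = c5 * h ∨ (h : Perm (Fin 6)) * c5 = c5⁻¹ * h := by
      rw [Subgroup.mem_comap] at hh
      rcases hcH _ hh with e | e
      · left
        ext1 i
        apply f.injective
        have := congrArg (fun g : ↥(alternatingGroup (Fin 6)) => (g : Perm (Fin 6)) (f i)) e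
        simp only [Subgroup.coe_mul, Perm.mul_apply, hfc, altCongr_apply'] at this
        simpa using this
      · right
        ext1 i
        apply f.injective
        have := congrArg (fun g : ↥(alternatingGroup (Fin 6)) => (g : Perm (Fin 6)) (f i)) e
        simp only [Subgroup.coe_mul, Subgroup.coe_inv, Perm.mul_apply, hfc, altCongr_apply', hfc'] at this
        simpa using this
    funext x
    rw [fnRep_apply]
    have := FF_inv h hcomm (h⁻¹ • x)
    rw [← this]
    congr 2
    ext1
    · exact (h : Perm (Fin 6)).apply_symm_apply x.1
    · exact (h : Perm (Fin 6)).apply_symm_apply x.2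
  · funext x
    have := congrArg (Int.cast : ℤ → k) (FF_sum x)
    push_cast at this
    simp only [Finset.sum_apply, one_smul, fnRep_apply, Pi.zero_apply]
    exact this
  · simp
    intro h
    have : ((8 : ℕ) : k) = 0 := by push_cast; linear_combination h
    rw [CharP.cast_eq_zero_iff k 3] at this
    omega
end


section
open Equiv

theorem embed {n : ℕ} (x : Fin n) : ∃ ι : ↥(alternatingGroup (Fin (n - 1))) →*
    ↥(alternatingGroup (Fin n)), Function.Injective ι ∧
      ι.range = MulAction.stabilizer ↥(alternatingGroup (Fin n)) x := by
  classical
  have hcard : (({x} : Finset (Fin n))ᶜ).card = n - 1 := by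
    rw [Finset.card_compl]; simp
  let e : Fin (n - 1) ≃ (({x} : Finset (Fin n))ᶜ : Finset (Fin n)) :=
    (Finset.equivFinOfCardEq hcard).symm
  refine ⟨(alternatingGroup.ofSubtype _).comp e.altCongrHom.toMonoidHom,
    alternatingGroup.ofSubtype_injective.comp e.altCongrHom.injective, ?_⟩
  rw [MonoidHom.range_comp, MonoidHom.range_eq_top.2
    (show Function.Surjective e.altCongrHom.toMonoidHom from e.altCongrHom.surjective),
    ← MonoidHom.range_eq_map]
  ext g
  rw [alternatingGroup.mem_range_ofSubtype_iff, MulAction.mem_stabilizer_iff]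
  constructor
  · intro h
    by_contra hne
    have : x ∈ (g : Perm (Fin n)).support := Perm.mem_support.2 hne
    have := h this
    simp at this
  · intro h y hy
    simp only [Finset.mem_compl, Finset.mem_singleton]
    rintro rfl
    exact Perm.mem_support.1 hy h

theorem fix_final {k : Type} [Field k] [IsAlgClosed k] {p : ℕ} [Fact p.Prime] [CharP k p] {n : ℕ}
    (hn : 5 ≤ n) (hp : p ≤ n)
    (H : Subgroup ↥(alternatingGroup (Fin n))) (hIp : HasIp k p H)
    (hmin : ∀ m, 5 ≤ m → m < n →
      ∀ (q : ℕ), q.Prime → q ≤ m →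
        ∀ (k' : Type) [Field k'] [IsAlgClosed k'] [CharP k' q],
          ∀ H' : Subgroup ↥(alternatingGroup (Fin m)), HasIp k' q H' → AltTable m q H')
    (hpn : p ∣ n) (x : Fin n) (hx : ∀ h ∈ H, (h : Perm (Fin n)) x = x) : AltTable n p H := by
  classical
  have hKP := KP_of_hasIp hIp
  have hprime : p.Prime := Fact.out
  obtain ⟨ι, hι, hr⟩ := embed x
  have hle : H ≤ ι.range := by
    rw [hr]; intro h hh
    exact hx h hh
  rcases hp.eq_or_lt with rfl | hlt
  · -- p = n
    obtain ⟨m, rfl⟩ : ∃ m, p = m + 1 := ⟨p - 1, by omega⟩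
    have hcard : Nat.card ι.range = m.factorial / 2 := by
      rw [Nat.card_congr (MonoidHom.ofInjective hι).symm.toEquiv]
      have : Nontrivial (Fin (m + 1 - 1)) := Fin.nontrivial_iff_two_le.2 (by omega)
      rw [nat_card_alternatingGroup, Nat.card_eq_fintype_card, Fintype.card_fin]
      rfl
    have hev : 2 ∣ m.factorial := Nat.dvd_factorial (by norm_num) (by omega)
    have hnd : ¬ (m + 1) ∣ Nat.card ι.range := by
      rw [hcard]
      intro h
      have h2 : (m + 1) ∣ m.factorial := h.trans (Nat.div_dvd_of_dvd hev)
      rw [hprime.dvd_factorial] at h2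
      omega
    have heq := hKP.max (p := m + 1) ι.range hnd hle
    refine Or.inl ⟨rfl, ⟨x, heq.trans hr⟩, ⟨?_⟩, ?_⟩
    · rw [heq]; exact (MonoidHom.ofInjective hι).symm
    · have : Nontrivial (Fin (m + 1)) := Fin.nontrivial_iff_two_le.2 (by omega)
      refine index_of_card H (m := m.factorial / 2) (by rw [heq, hcard]) ?_
        (Nat.div_pos (Nat.le_of_dvd (Nat.factorial_pos _) hev) (by norm_num))
      rw [nat_card_alternatingGroup, Nat.card_eq_fintype_card, Fintype.card_fin,
        Nat.factorial_succ, Nat.mul_div_assoc _ hev, mul_comm]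
  · have hn6 : 6 ≤ n := by
      by_contra hlt6
      have : n = 5 := by omega
      subst this
      have := (Nat.prime_dvd_prime_iff_eq hprime (by norm_num)).1 hpn
      omega
    exfalso
    have hcard : Nat.card (H.comap ι) = Nat.card H := by
      have e1 : (H.comap ι).map ι = H := by
        rw [Subgroup.map_comap_eq, inf_eq_right]; exact hle
      rw [← e1, Subgroup.card_map_of_injective hι, e1]
    have htab := hmin (n - 1) (by omega) (by omega) p hprime (by omega) k _
      (hKP.sub hIp.1 ι hι hle)
    rcases htab with h | h | h | h | h | h | h
    · obtain ⟨h, -⟩ := h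
      have : p ∣ 1 := by
        have h3 : n = p + 1 := by omega
        rw [h3] at hpn
        exact (Nat.dvd_add_right (dvd_refl p)).1 hpn
      exact hprime.one_lt.ne' (Nat.dvd_one.1 this)
    · obtain ⟨h1, rfl, -, h2, -⟩ := h
      have : n = 6 := by omega
      subst this
      have := hKP.order (p := 2) psi9.range (by rw [card_K9]; decide)
      rw [card_K9] at this
      omega
    · obtain ⟨h1, rfl, ⟨e⟩, -⟩ := h
      have : n = 6 := by omega
      subst this
      let c := e.symm (DihedralGroup.r 1)
      have hc5 : c ^ 5 = 1 := by
        rw [← map_pow]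
        have : (DihedralGroup.r 1 : DihedralGroup 5) ^ 5 = 1 := by decide
        rw [this, map_one]
      have hc1 : c ≠ 1 := by
        intro h
        have : (DihedralGroup.r 1 : DihedralGroup 5) = 1 := by
          rw [← e.apply_symm_apply (DihedralGroup.r 1)]
          change e c = 1
          rw [h, map_one]
        revert this; decide
      have hD : ∀ d : DihedralGroup 5, d * DihedralGroup.r 1 = DihedralGroup.r 1 * d ∨
          d * DihedralGroup.r 1 = (DihedralGroup.r 1)⁻¹ * d := by decide
      refine caseD5 H hIp (ι c.1) ?_ ?_ ?_
      · rw [← map_pow]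
        have := congrArg Subtype.val hc5
        rw [Subgroup.coe_pow] at this
        rw [this]; exact map_one ι
      · intro h
        apply hc1
        apply Subtype.ext
        apply hι
        rw [h]; exact (map_one ι).symm
      · intro h hh
        obtain ⟨g, rfl⟩ := hle hh
        let g' : H.comap ι := ⟨g, hh⟩
        have key : g' * c = c * g' ∨ g' * c = c⁻¹ * g' := by
          rcases hD (e g') with h | h
          · left
            apply e.injective
            rw [map_mul, map_mul]
            simpa [c] using h
          · right
            apply e.injective
            rw [map_mul, map_mul, map_inv]
            simpa [c] using h
        rcases key with h | h
        · left
          have := congrArg (fun z : H.comap ι => ι z.1) h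
          simpa [g'] using this
        · right
          have := congrArg (fun z : H.comap ι => ι z.1) h
          simpa [g'] using this
    · obtain ⟨h1, rfl, -⟩ := h; omega
    · obtain ⟨h1, rfl, -⟩ := h; omega
    · obtain ⟨h1, rfl, -⟩ := h; omega
    · obtain ⟨h1, rfl, -⟩ := h; omega

/-- The setwise stabilizer. -/
def Lst {n : ℕ} (A : Finset (Fin n)) : Subgroup ↥(alternatingGroup (Fin n)) where
  carrier := {g | ∀ x, (g : Perm (Fin n)) x ∈ A ↔ x ∈ A}
  one_mem' := by intro x; simp
  mul_mem' := by
    intro g h hg hh x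
    rw [Subgroup.coe_mul, Perm.mul_apply, hg, hh]
  inv_mem' := by
    intro g hg x
    rw [← hg, Subgroup.coe_inv]
    simp

/-- Restriction to an invariant set. -/
def resA {n : ℕ} (A : Finset (Fin n)) : Lst A →* Perm A where
  toFun g := Perm.subtypePerm (g.1 : Perm (Fin n)) g.2
  map_one' := by ext; simp
  map_mul' g h := by ext; rfl

theorem resA_apply {n : ℕ} (A : Finset (Fin n)) (g : Lst A) (x : A) :
    ((resA A g) x : Fin n) = (g.1 : Perm (Fin n)) x := rfl

/-- Two invariant parts, one of them of length at least seven, `p = 2`. -/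
theorem big_final {k : Type} [Field k] [IsAlgClosed k] [CharP k 2] {n : ℕ}
    (H : Subgroup ↥(alternatingGroup (Fin n))) (hIp : HasIp k 2 H)
    (hmin : ∀ m, 5 ≤ m → m < n →
      ∀ (q : ℕ), q.Prime → q ≤ m →
        ∀ (k' : Type) [Field k'] [IsAlgClosed k'] [CharP k' q],
          ∀ H' : Subgroup ↥(alternatingGroup (Fin m)), HasIp k' q H' → AltTable m q H')
    (A : Finset (Fin n)) (hA : ∀ h ∈ H, A.image (h : Perm (Fin n)) = A)
    (h7 : 7 ≤ A.card) (hlt : A.card < n) : False := by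
  classical
  have hKP := KP_of_hasIp hIp
  have hmem : ∀ h ∈ H, ∀ x, (h : Perm (Fin n)) x ∈ A ↔ x ∈ A := by
    intro h hh x
    conv_lhs => rw [← hA h hh]
    simp
  let L := (alternatingGroup A).comap (resA A)
  let j : L →* ↥(alternatingGroup (Fin n)) := (Lst A).subtype.comp L.subtype
  have hj : Function.Injective j := (Lst A).subtype_injective.comp L.subtype_injective
  have hle : H ≤ j.range := by
    intro h hh
    have hL : resA A ⟨h, hmem h hh⟩ ∈ alternatingGroup A := by
      rw [Perm.mem_alternatingGroup]
      rcases Int.units_eq_one_or (Perm.sign (resA A ⟨h, hmem h hh⟩)) with e | e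
      · exact e
      · exfalso
        have hpow : h ^ Nat.card H = 1 := by
          have := pow_card_eq_one' (x := (⟨h, hh⟩ : H))
          exact congrArg Subtype.val this
        have : (⟨h, hmem h hh⟩ : Lst A) ^ Nat.card H = 1 := Subtype.ext hpow
        have h2 := congrArg (fun g => Perm.sign (resA A g)) this
        simp only [map_pow, e, map_one] at h2
        have hodd : Odd (Nat.card H) := Nat.not_even_iff_odd.1 (fun h => hIp.1 h.two_dvd)
        rw [hodd.neg_one_pow] at h2
        exact absurd h2 (by decide)
    exact ⟨⟨⟨h, hmem h hh⟩, hL⟩, rfl⟩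
  have hIp1 := hKP.sub hIp.1 j hj hle
  let π0 : L →* ↥(alternatingGroup A) := (resA A).subgroupComap (alternatingGroup A)
  have hπ0 : Function.Surjective π0 := by
    intro g
    have hg : alternatingGroup.ofSubtype A g ∈ Lst A := fun x =>
      Perm.ofSubtype_apply_mem_iff_mem (g : Perm A) x
    have hres : resA A ⟨alternatingGroup.ofSubtype A g, hg⟩ = g :=
      Perm.subtypePerm_ofSubtype (g : Perm A)
    refine ⟨⟨⟨alternatingGroup.ofSubtype A g, hg⟩, ?_⟩, Subtype.ext hres⟩
    rw [Subgroup.mem_comap, hres]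
    exact g.2
  let e : A ≃ Fin A.card := A.equivFin
  let π : L →* ↥(alternatingGroup (Fin A.card)) := e.altCongrHom.toMonoidHom.comp π0
  have hπ : Function.Surjective π := e.altCongrHom.surjective.comp hπ0
  have hIp2 := (KP_of_hasIp hIp1).quot hIp1.1 π hπ
  have htab := hmin A.card (by omega) hlt 2 Nat.prime_two (by omega) k _ hIp2
  rcases htab with h | h | h | h | h | h | h
  · have := h.1; omega
  · have := h.1; omega
  · have := h.1; omega
  · have := h.1; omega
  · have := h.1; omega
  · have := h.2.1; omega
  · have := h.2.1; omega

theorem intrans_final {k : Type} [Field k] [IsAlgClosed k] {p : ℕ} [Fact p.Prime] [CharP k p] {n : ℕ}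
    (hn : 5 ≤ n) (hp : p ≤ n)
    (H : Subgroup ↥(alternatingGroup (Fin n))) (hIp : HasIp k p H)
    (hmin : ∀ m, 5 ≤ m → m < n →
      ∀ (q : ℕ), q.Prime → q ≤ m →
        ∀ (k' : Type) [Field k'] [IsAlgClosed k'] [CharP k' q],
          ∀ H' : Subgroup ↥(alternatingGroup (Fin m)), HasIp k' q H' → AltTable m q H')
    (a b : Fin n) (hab : ¬ ∃ h : ↥(alternatingGroup (Fin n)), h ∈ H ∧ (h : Perm (Fin n)) a = b) :
    AltTable n p H := by
  classical
  have hKP := KP_of_hasIp hIp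
  have hn3 : 3 ≤ Fintype.card (Fin n) := by simp; omega
  let A : Finset (Fin n) := Finset.univ.filter (fun y => ∃ h ∈ H, (h : Perm (Fin n)) a = y)
  have hmem : ∀ h ∈ H, ∀ x, (h : Perm (Fin n)) x ∈ A ↔ x ∈ A := by
    intro h hh x
    simp only [A, Finset.mem_filter, Finset.mem_univ, true_and]
    constructor
    · rintro ⟨g, hg, e⟩
      exact ⟨h⁻¹ * g, H.mul_mem (H.inv_mem hh) hg, by simp [e]⟩
    · rintro ⟨g, hg, e⟩
      exact ⟨h * g, H.mul_mem hh hg, by simp [e]⟩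
  have hinv : ∀ C : Finset (Fin n), (∀ h ∈ H, ∀ x, (h : Perm (Fin n)) x ∈ C ↔ x ∈ C) →
      ∀ h ∈ H, C.image (h : Perm (Fin n)) = C := by
    intro C hC h hh
    apply Finset.eq_of_subset_of_card_le
    · intro y hy
      obtain ⟨x, hx, rfl⟩ := Finset.mem_image.1 hy
      exact (hC h hh x).2 hx
    · rw [Finset.card_image_of_injective _ (Equiv.injective _)]
  have hA := hinv A hmem
  have hAc := hinv Aᶜ (fun h hh x => by rw [Finset.mem_compl, Finset.mem_compl, hmem h hh])
  have ha : a ∈ A := by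
    simp only [A, Finset.mem_filter, Finset.mem_univ, true_and]
    exact ⟨1, H.one_mem, rfl⟩
  have hb : b ∉ A := by
    simp only [A, Finset.mem_filter, Finset.mem_univ, true_and]
    rintro ⟨h, hh, e⟩; exact hab ⟨h, hh, e⟩
  obtain ⟨hnk, hsk⟩ := intrans1 hKP hn3 A hA ⟨a, ha⟩ (fun h => hb (h ▸ Finset.mem_univ b))
  rw [Fintype.card_fin, CharP.cast_eq_zero_iff k p] at hnk
  have hfix : ∀ C : Finset (Fin n), (∀ h ∈ H, C.image (h : Perm (Fin n)) = C) → C.card = 1 →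
      AltTable n p H := by
    intro C hC hC1
    obtain ⟨x, rfl⟩ := Finset.card_eq_one.1 hC1
    refine fix_final hn hp H hIp hmin hnk x ?_
    intro h hh
    have := hC h hh
    simpa using this
  have hcc : (Aᶜ).card = n - A.card := by rw [Finset.card_compl, Fintype.card_fin]
  have hApos : 0 < A.card := Finset.card_pos.2 ⟨a, ha⟩
  have hAcpos : 0 < (Aᶜ).card := Finset.card_pos.2 ⟨b, by simpa using hb⟩
  by_cases h1 : A.card = 1
  · exact hfix A hA h1
  by_cases h2 : (Aᶜ).card = 1
  · exact hfix Aᶜ hAc h2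
  obtain ⟨h20, hm1⟩ := intrans2 hKP hn3 A hA (by omega) (by rw [Fintype.card_fin]; omega)
  obtain ⟨-, hm2⟩ := intrans2 hKP hn3 Aᶜ hAc (by omega) (by rw [Fintype.card_fin]; omega)
  have hp2 : p = 2 := by
    have : ((2 : ℕ) : k) = 0 := by exact_mod_cast h20
    rw [CharP.cast_eq_zero_iff k p] at this
    exact (Nat.prime_dvd_prime_iff_eq Fact.out (by norm_num)).1 this
  subst hp2
  rw [Ne, CharP.cast_eq_zero_iff k 2] at hsk
  by_cases hA7 : 7 ≤ A.card
  · exact (big_final H hIp hmin A hA hA7 (by omega)).elim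
  by_cases hA7' : 7 ≤ (Aᶜ).card
  · exact (big_final H hIp hmin Aᶜ hAc hA7' (by omega)).elim
  have hA3 : A.card = 3 := by omega
  have hn6 : n = 6 := by omega
  subst hn6
  exact case33 H hIp A hA hA3
end

theorem stmt10 (k : Type) [Field k] (p : ℕ) [Fact p.Prime] [IsAlgClosed k] [CharP k p]
    (n : ℕ) (hn : 5 ≤ n) (hp : p ≤ n) (H : Subgroup ↥(alternatingGroup (Fin n)))
    (hIp : HasIp k p H) (hnotable : ¬ AltTable n p H)
    (hmin : ∀ m, 5 ≤ m → m < n →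
      ∀ (q : ℕ), q.Prime → q ≤ m →
        ∀ (k' : Type) [Field k'] [IsAlgClosed k'] [CharP k' q],
          ∀ H' : Subgroup ↥(alternatingGroup (Fin m)), HasIp k' q H' → AltTable m q H') :
    (∀ a b : Fin n, ∃ h : ↥(alternatingGroup (Fin n)),
      h ∈ H ∧ (h : Equiv.Perm (Fin n)) a = b) ∧
    (∀ B : Set (Fin n),
      (∀ h : ↥(alternatingGroup (Fin n)), h ∈ H →
        (h : Equiv.Perm (Fin n)) '' B = B ∨ Disjoint ((h : Equiv.Perm (Fin n)) '' B) B) →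
      B.Subsingleton ∨ B = Set.univ) := by
  have htrans : ∀ a b : Fin n, ∃ h : ↥(alternatingGroup (Fin n)),
      h ∈ H ∧ (h : Equiv.Perm (Fin n)) a = b := by
    intro a b
    by_contra hab
    exact hnotable (intrans_final hn hp H hIp hmin a b hab)
  refine ⟨htrans, ?_⟩
  intro B hB
  by_contra hcon
  rw [not_or] at hcon
  exact hnotable (impr_final hn H hIp htrans B hB hcon.1 hcon.2)
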